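/- arXiv:1311.5878 — 3 statements merged into one kernel-verified Lean document; each statement's English description precedes it below -/
import Mathlib

section
/- Let (X, Y, π) be an irreducible factor triple of class degree d with X one-step and π one-block, and let w be a magic block of π. Then there is a partition of π⁻¹(w) into d subsets B_1, …, B_d such that for every doubly transitive z ∈ Y and every i ∈ ℤ with z_{[i, i+|w|)} = w, there is a bijection ρ : C(z) → {1, …, d} with D|_{[i,i+|w|)} ⊆ B_{ρ(D)} for each transition class D over z. -/
open Set

universe u v uc

variable {A : Type u} {B : Type v}

/-- The shift by `n` on points of the full shift `ℤ → A`. -/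
def shiftMap (n : ℤ) (x : ℤ → A) : ℤ → A := fun i => x (i + n)

/-- A subshift: a closed, shift-invariant subset of the full shift. -/
def IsSubshift [TopologicalSpace A] (X : Set (ℤ → A)) : Prop :=
  IsClosed X ∧ ∀ n : ℤ, ∀ x ∈ X, shiftMap n x ∈ X

/-- The block `u` (of length `p`) occurs in `X`. -/
def OccursIn {p : ℕ} (u : Fin p → A) (X : Set (ℤ → A)) : Prop :=
  ∃ x ∈ X, ∃ i : ℤ, ∀ j : Fin p, x (i + (j.1 : ℤ)) = u j

/-- A shift of finite type: a subshift determined by a set of allowed `k`-blocks. -/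
def IsSFT [TopologicalSpace A] (X : Set (ℤ → A)) : Prop :=
  IsSubshift X ∧ ∃ (k : ℕ) (P : (Fin k → A) → Prop),
    X = {x | ∀ i : ℤ, P fun j => x (i + (j.1 : ℤ))}

/-- A one-step shift of finite type: determined by allowed 2-blocks. -/
def IsOneStep [TopologicalSpace A] (X : Set (ℤ → A)) : Prop :=
  IsSubshift X ∧ ∃ T : A → A → Prop, X = {x | ∀ i : ℤ, T (x i) (x (i + 1))}

/-- Irreducibility: any two blocks of `X` can be seen in a single point of `X`,
the second occurring after the first. -/
def IrreducibleSubshift [TopologicalSpace A] (X : Set (ℤ → A)) : Prop :=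
  ∀ (p q : ℕ) (u : Fin p → A) (w : Fin q → A),
    OccursIn u X → OccursIn w X →
      ∃ x ∈ X, ∃ i k : ℤ, i + (p : ℤ) ≤ k ∧
        (∀ j : Fin p, x (i + (j.1 : ℤ)) = u j) ∧ ∀ j : Fin q, x (k + (j.1 : ℤ)) = w j

/-- A sliding block code: given by a local rule on a finite window. -/
def IsSlidingBlockCode (π : (ℤ → A) → ℤ → B) : Prop :=
  ∃ (r : ℕ) (Φ : (Fin (2 * r + 1) → A) → B),
    ∀ x i, π x i = Φ fun j => x (i - (r : ℤ) + (j.1 : ℤ))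

/-- A one-block code. -/
def IsOneBlock (π : (ℤ → A) → ℤ → B) : Prop :=
  ∃ Φ : A → B, ∀ x i, π x i = Φ (x i)

/-- `Φ` is a one-block local rule for `π`. -/
def OneBlockRule (π : (ℤ → A) → ℤ → B) (Φ : A → B) : Prop :=
  ∀ x i, π x i = Φ (x i)

/-- A factor code from `X` onto `Y`. -/
def IsFactorCode (X : Set (ℤ → A)) (Y : Set (ℤ → B)) (π : (ℤ → A) → ℤ → B) : Prop :=
  IsSlidingBlockCode π ∧ (∀ x ∈ X, π x ∈ Y) ∧ ∀ y ∈ Y, ∃ x ∈ X, π x = y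

/-- A factor triple: a factor code from an SFT `X` onto the subshift `Y`. -/
def FactorTriple [TopologicalSpace A] [TopologicalSpace B]
    (X : Set (ℤ → A)) (Y : Set (ℤ → B)) (π : (ℤ → A) → ℤ → B) : Prop :=
  IsSFT X ∧ IsSubshift Y ∧ IsFactorCode X Y π

/-- Transition `x → x'`: for each `n` there is `z` in the fiber agreeing with `x`
on `(-∞, n]` and with `x'` on `[i, ∞)` for some `i ≥ n`. -/
def TransitionTo (X : Set (ℤ → A)) (π : (ℤ → A) → ℤ → B) (x x' : ℤ → A) : Prop :=
  ∀ n : ℤ, ∃ z ∈ X, π z = π x ∧ (∀ m ≤ n, z m = x m) ∧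
    ∃ i : ℤ, n ≤ i ∧ ∀ m : ℤ, i ≤ m → z m = x' m

/-- `x ~ x'`: transitions in both directions. -/
def TransEquiv (X : Set (ℤ → A)) (π : (ℤ → A) → ℤ → B) (x x' : ℤ → A) : Prop :=
  TransitionTo X π x x' ∧ TransitionTo X π x' x

/-- The transition class of `x` (within the fiber of `π x`). -/
def transClass (X : Set (ℤ → A)) (π : (ℤ → A) → ℤ → B) (x : ℤ → A) : Set (ℤ → A) :=
  {x' | x' ∈ X ∧ π x' = π x ∧ TransEquiv X π x x'}

/-- The set of transition classes over `y`. -/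
def transClassesOver (X : Set (ℤ → A)) (π : (ℤ → A) → ℤ → B) (y : ℤ → B) :
    Set (Set (ℤ → A)) :=
  {C | ∃ x, x ∈ X ∧ π x = y ∧ C = transClass X π x}

/-- Right transitive point: its forward orbit is dense in `X`. -/
def RightTransitive (X : Set (ℤ → A)) (x : ℤ → A) : Prop :=
  x ∈ X ∧ ∀ z ∈ X, ∀ N : ℕ, ∃ n : ℤ, 0 ≤ n ∧ ∀ m : ℤ, |m| ≤ (N : ℤ) → x (m + n) = z m

/-- Left transitive point: its backward orbit is dense in `X`. -/
def LeftTransitive (X : Set (ℤ → A)) (x : ℤ → A) : Prop :=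
  x ∈ X ∧ ∀ z ∈ X, ∀ N : ℕ, ∃ n : ℤ, n ≤ 0 ∧ ∀ m : ℤ, |m| ≤ (N : ℤ) → x (m + n) = z m

/-- Doubly transitive point. -/
def DoublyTransitive (X : Set (ℤ → A)) (x : ℤ → A) : Prop :=
  RightTransitive X x ∧ LeftTransitive X x

def MutuallySeparated (x x' : ℤ → A) : Prop := ∀ i : ℤ, x i ≠ x' i

def RightAsymptotic (x x' : ℤ → A) : Prop := ∃ N : ℤ, ∀ m : ℤ, N ≤ m → x m = x' m

def LeftAsymptotic (x x' : ℤ → A) : Prop := ∃ N : ℤ, ∀ m : ℤ, m ≤ N → x m = x' m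

/-- The class degree: the minimal number of transition classes over points of `Y`. -/
noncomputable def classDegree (X : Set (ℤ → A)) (Y : Set (ℤ → B))
    (π : (ℤ → A) → ℤ → B) : ℕ :=
  sInf {d | ∃ y ∈ Y, Nat.card (transClassesOver X π y) = d}

/-- The preimage blocks of a `Y`-block `w` under the one-block rule `Φ`. -/
def blockPre (X : Set (ℤ → A)) (Φ : A → B) {p : ℕ} (w : Fin p → B) : Set (Fin p → A) :=
  {u | OccursIn u X ∧ ∀ j, Φ (u j) = w j}

/-- `u ∈ π⁻¹(w)` is routable through `a` at time `n`. -/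
def Routable (X : Set (ℤ → A)) (Φ : A → B) {p : ℕ} (w : Fin (p + 1) → B)
    (u : Fin (p + 1) → A) (n : Fin (p + 1)) (a : A) : Prop :=
  ∃ u' ∈ blockPre X Φ w, u' 0 = u 0 ∧ u' (Fin.last p) = u (Fin.last p) ∧ u' n = a

/-- `(w, n, M)` is a transition block. -/
def IsTransBlock (X : Set (ℤ → A)) (Y : Set (ℤ → B)) (Φ : A → B) {p : ℕ}
    (w : Fin (p + 1) → B) (n : Fin (p + 1)) (M : Set A) : Prop :=
  OccursIn w Y ∧ 0 < n.1 ∧ n.1 < p ∧ (∀ a ∈ M, Φ a = w n) ∧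
    ∀ u ∈ blockPre X Φ w, ∃ a ∈ M, Routable X Φ w u n a

/-- `c*_π`: the minimal depth of a transition block. -/
noncomputable def minDepth (X : Set (ℤ → A)) (Y : Set (ℤ → B)) (Φ : A → B) : ℕ :=
  sInf {d | ∃ (p : ℕ) (w : Fin (p + 1) → B) (n : Fin (p + 1)) (M : Set A),
    IsTransBlock X Y Φ w n M ∧ Nat.card M = d}

/-- A minimal transition block. -/
def IsMinTransBlock (X : Set (ℤ → A)) (Y : Set (ℤ → B)) (Φ : A → B) {p : ℕ}
    (w : Fin (p + 1) → B) (n : Fin (p + 1)) (M : Set A) : Prop :=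
  IsTransBlock X Y Φ w n M ∧ Nat.card M = minDepth X Y Φ

/-- `d(w)`: the minimal number of symbols seen at a single coordinate among
the preimages of `w`. -/
noncomputable def dval (X : Set (ℤ → A)) (Φ : A → B) {p : ℕ} (w : Fin p → B) : ℕ :=
  sInf {m | ∃ k : Fin p, Nat.card {a : A | ∃ u ∈ blockPre X Φ w, u k = a} = m}

/-- A magic block: a block of `Y` minimizing `d(·)`. -/
def IsMagicBlock (X : Set (ℤ → A)) (Y : Set (ℤ → B)) (Φ : A → B) {p : ℕ}
    (w : Fin (p + 1) → B) : Prop :=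
  OccursIn w Y ∧
    dval X Φ w = sInf {m | ∃ (q : ℕ) (v : Fin (q + 1) → B), OccursIn v Y ∧ dval X Φ v = m}

/-- An `(X̄, v̄)`-diamond: blocks `u, v` of `X` with the same image, same
endpoints, `u` occurring in `X̄` and `v̄` a subblock of `v`. -/
def IsDiamond (X Xbar : Set (ℤ → A)) (Φ : A → B) {q p : ℕ} (vbar : Fin q → A)
    (u v : Fin (p + 1) → A) : Prop :=
  OccursIn u Xbar ∧ OccursIn v X ∧ (∀ j, Φ (u j) = Φ (v j)) ∧
    (∃ (s : ℕ) (_ : s + q ≤ p + 1), ∀ j : Fin q,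
      v ⟨s + j.1, by have := j.2; omega⟩ = vbar j) ∧
    u 0 = v 0 ∧ u (Fin.last p) = v (Fin.last p)

/-- Reversed transition `x →_r x'`. -/
def RevTransitionTo (X : Set (ℤ → A)) (π : (ℤ → A) → ℤ → B) (x x' : ℤ → A) : Prop :=
  ∀ n : ℤ, ∃ z ∈ X, π z = π x ∧ (∀ m : ℤ, n ≤ m → z m = x' m) ∧
    ∃ i : ℤ, i ≤ n ∧ ∀ m ≤ i, z m = x m

def RevTransEquiv (X : Set (ℤ → A)) (π : (ℤ → A) → ℤ → B) (x x' : ℤ → A) : Prop :=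
  RevTransitionTo X π x x' ∧ RevTransitionTo X π x' x

/-- The reversed transition class of `x`. -/
def revClass (X : Set (ℤ → A)) (π : (ℤ → A) → ℤ → B) (x : ℤ → A) : Set (ℤ → A) :=
  {x' | x' ∈ X ∧ π x' = π x ∧ RevTransEquiv X π x x'}

open scoped Classical in
/-- The standard metric on the full shift. -/
noncomputable def shiftDist (x x' : ℤ → A) : ℝ :=
  if x = x' then 0
  else
    let k : ℕ := sInf {k : ℕ | x (k : ℤ) ≠ x' (k : ℤ) ∨ x (-(k : ℤ)) ≠ x' (-(k : ℤ))}
    (2 : ℝ) ^ (-(k : ℤ))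

namespace MBP

/-- A path from `a` at time `s` to `b` at time `t` lying over `y`. -/
def Pth (X : Set (ℤ → A)) (Φ : A → B) (y : ℤ → B) (s t : ℤ) (a b : A) : Prop :=
  ∃ x ∈ X, x s = a ∧ x t = b ∧ ∀ i, s ≤ i → i ≤ t → Φ (x i) = y i

/-- `x` may be rerouted through `a` at time `m` within the window of radius `L`. -/
def Conn (X : Set (ℤ → A)) (Φ : A → B) (y : ℤ → B) (L : ℕ) (x : ℤ → A) (m : ℤ) (a : A) : Prop :=
  Pth X Φ y (m - L) m (x (m - L)) a ∧ Pth X Φ y m (m + L) a (x (m + L))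

def TBat (X : Set (ℤ → A)) (Φ : A → B) (y : ℤ → B) (m : ℤ) (L : ℕ) (M : Set A) : Prop :=
  ∀ x ∈ X, (∀ i, m - L ≤ i → i ≤ m + L → Φ (x i) = y i) → ∃ a ∈ M, Conn X Φ y L x m a

def Occ (y0 : ℤ → B) (L : ℕ) (y : ℤ → B) (m : ℤ) : Prop :=
  ∀ i : ℤ, -(L : ℤ) ≤ i → i ≤ L → y (i + m) = y0 i

structure Setup (X : Set (ℤ → A)) (Y : Set (ℤ → B)) (Φ : A → B) : Prop where
  glue : ∀ x ∈ X, ∀ x' ∈ X, ∀ t : ℤ, x t = x' t → (fun i => if i ≤ t then x i else x' i) ∈ X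
  shX : ∀ n : ℤ, ∀ x ∈ X, (fun i => x (i + n)) ∈ X
  shY : ∀ n : ℤ, ∀ y ∈ Y, (fun i => y (i + n)) ∈ Y
  img : ∀ x ∈ X, (fun i => Φ (x i)) ∈ Y
  surj : ∀ y ∈ Y, ∃ x ∈ X, (fun i => Φ (x i)) = y

structure MinTB (X : Set (ℤ → A)) (Y : Set (ℤ → B)) (Φ : A → B) (y0 : ℤ → B) (L : ℕ)
    (M : Set A) : Prop where
  mem : y0 ∈ Y
  tb : TBat X Φ y0 0 L M
  min : ∀ y ∈ Y, ∀ (L' : ℕ) (M' : Set A), TBat X Φ y 0 L' M' → M.ncard ≤ M'.ncard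

section basic
variable {X : Set (ℤ → A)} {Y : Set (ℤ → B)} {Φ : A → B}

lemma Pth.self {x : ℤ → A} (hx : x ∈ X) {y : ℤ → B} {s t : ℤ}
    (h : ∀ i, s ≤ i → i ≤ t → Φ (x i) = y i) : Pth X Φ y s t (x s) (x t) :=
  ⟨x, hx, rfl, rfl, h⟩

lemma Pth.trans (hS : Setup X Y Φ) {y : ℤ → B} {s t r : ℤ} {a b c : A}
    (h1 : Pth X Φ y s t a b) (h2 : Pth X Φ y t r b c) (hst : s ≤ t) (htr : t ≤ r) :
    Pth X Φ y s r a c := by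
  obtain ⟨x, hx, rfl, rfl, h⟩ := h1
  obtain ⟨x', hx', e, rfl, h'⟩ := h2
  refine ⟨_, hS.glue x hx x' hx' t e.symm, by simp [hst], ?_, ?_⟩
  · by_cases hr : r ≤ t
    · have : r = t := le_antisymm hr htr
      subst this; simp [e]
    · simp [hr]
  · intro i h1 h2
    by_cases hi : i ≤ t
    · simp [hi, h i h1 hi]
    · simp [hi, h' i (by omega) h2]

lemma Pth.shift (hS : Setup X Y Φ) {y y' : ℤ → B} {s t s' t' : ℤ} {a b : A} (h : ℤ)
    (hp : Pth X Φ y s t a b) (hs : s' = s + h) (ht : t' = t + h)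
    (e : ∀ i, s ≤ i → i ≤ t → y' (i + h) = y i) : Pth X Φ y' s' t' a b := by
  obtain ⟨x, hx, rfl, rfl, hh⟩ := hp
  subst hs ht
  refine ⟨_, hS.shX (-h) x hx, by simp, by simp, ?_⟩
  intro i h1 h2
  have := e (i + -h) (by omega) (by omega)
  rw [hh _ (by omega) (by omega), ← this]; simp

lemma Pth.congr {y y' : ℤ → B} {s t : ℤ} {a b : A}
    (hp : Pth X Φ y s t a b)
    (e : ∀ i, s ≤ i → i ≤ t → y' i = y i) : Pth X Φ y' s t a b := by
  obtain ⟨x, hx, rfl, rfl, hh⟩ := hp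
  exact ⟨x, hx, rfl, rfl, fun i h1 h2 => by rw [hh i h1 h2, e i h1 h2]⟩

/-- Splicing of fibre points along a path. -/
lemma splice (hS : Setup X Y Φ) {z : ℤ → B} {x x' : ℤ → A} (hx : x ∈ X) (hx' : x' ∈ X)
    (e : ∀ i, Φ (x i) = z i) (e' : ∀ i, Φ (x' i) = z i) {s t : ℤ} (hst : s ≤ t)
    (hp : Pth X Φ z s t (x s) (x' t)) :
    ∃ v ∈ X, (∀ i, Φ (v i) = z i) ∧ (∀ i ≤ s, v i = x i) ∧ (∀ i, t ≤ i → v i = x' i) := by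
  obtain ⟨q, hq, q1, q2, h⟩ := hp
  have g1 := hS.glue x hx q hq s q1.symm
  have g2 := hS.glue _ g1 x' hx' t (by
    by_cases hh : t ≤ s
    · have : s = t := le_antisymm hst hh
      subst this; simp [← q1, q2]
    · simp [hh, q2])
  refine ⟨_, g2, ?_, ?_, ?_⟩
  · intro i
    by_cases h1 : i ≤ t
    · by_cases h2 : i ≤ s
      · simp [h1, h2, e]
      · simp [h1, h2, h i (by omega) h1]
    · simp [h1, e']
  · intro i hi
    simp [hi, hi.trans hst]
  · intro i hi
    by_cases h1 : i ≤ t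
    · have : i = t := le_antisymm h1 hi
      subst this
      by_cases h2 : i ≤ s
      · have : i = s := le_antisymm h2 hst
        subst this; simp [← q1, q2]
      · simp [h2, q2]
    · simp [h1]

lemma Occ.tb (hS : Setup X Y Φ) {y0 y : ℤ → B} {L : ℕ} {m : ℤ} {M : Set A}
    (h : Occ y0 L y m) (htb : TBat X Φ y0 0 L M) : TBat X Φ y m L M := by
  intro x hx hxy
  obtain ⟨a, ha, h1, h2⟩ := htb _ (hS.shX m x hx) (by
    intro i h1 h2
    rw [hxy _ (by omega) (by omega), h i (by omega) (by omega)])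
  refine ⟨a, ha, ?_, ?_⟩
  · have := h1.shift hS (y' := y) (s' := m - L) (t' := m) m (by ring) (by ring) (fun i h1 h2 => h i (by omega) (by omega))
    convert this using 2; ring
  · have := h2.shift hS (y' := y) (s' := m) (t' := m + L) m (by ring) (by ring) (fun i h1 h2 => h i (by omega) (by omega))
    convert this using 2; ring

/-- joining two routings of the same point -/
lemma Conn.path (hS : Setup X Y Φ) {y : ℤ → B} {L : ℕ} {x : ℤ → A} (hx : x ∈ X) {m n : ℤ}
    {a b : A} (hmn : m + 2 * L ≤ n) (e : ∀ i, m + L ≤ i → i ≤ n - L → Φ (x i) = y i)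
    (h1 : Conn X Φ y L x m a) (h2 : Conn X Φ y L x n b) : Pth X Φ y m n a b :=
  (h1.2.trans hS (Pth.self hx e) (by omega) (by omega)).trans hS h2.1 (by omega) (by omega)

lemma rt_occ (hS : Setup X Y Φ) {z : ℤ → B} (hz : RightTransitive Y z) {y : ℤ → B} (hy : y ∈ Y)
    (H : ℤ) (N : ℕ) : ∃ h, H ≤ h ∧ ∀ m : ℤ, -(N : ℤ) ≤ m → m ≤ N → z (m + h) = y m := by
  obtain ⟨n, hn, h⟩ := hz.2 _ (hS.shY (-(|H|)) y hy) (N + H.natAbs)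
  refine ⟨n + |H|, by have := le_abs_self H; omega, fun m h1 h2 => ?_⟩
  have := h (m + |H|) (by rw [abs_le]; push_cast; constructor <;> cases abs_cases H <;> omega)
  rw [show m + (n + |H|) = m + |H| + n by ring, this]; simp

lemma lt_occ (hS : Setup X Y Φ) {z : ℤ → B} (hz : LeftTransitive Y z) {y : ℤ → B} (hy : y ∈ Y)
    (H : ℤ) (N : ℕ) : ∃ h, h ≤ H ∧ ∀ m : ℤ, -(N : ℤ) ≤ m → m ≤ N → z (m + h) = y m := by
  obtain ⟨n, hn, h⟩ := hz.2 _ (hS.shY (|H|) y hy) (N + H.natAbs)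
  refine ⟨n - |H|, by have := neg_abs_le H; omega, fun m h1 h2 => ?_⟩
  have := h (m - |H|) (by rw [abs_le]; push_cast; constructor <;> cases abs_cases H <;> omega)
  rw [show m + (n - |H|) = m - |H| + n by ring, this]; simp

end basic
section abstr

/-- The combinatorial core: in a transitive semigroup-like family of relations all containing
permutations, and in which no two elements can be merged, all relations are permutations. -/
lemma abstract_core {M : Type*} [Finite M] (S : Set (M → M → Prop))
    (hcomp : ∀ R ∈ S, ∀ R' ∈ S, ∃ Q ∈ S, ∀ a b c, R a b → R' b c → Q a c)
    (hperm : ∀ R ∈ S, ∃ σ : Equiv.Perm M, ∀ a, R a (σ a))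
    (htrans : ∀ a b, ∃ R ∈ S, R a b)
    (hmerge : ∀ Z ∈ S, (∀ a, Z a a) → (∀ a b c, Z a b → Z b c → Z a c) →
      ∀ a b, Z a b → Z b a → a = b) :
    ∀ R ∈ S, ∃ σ : Equiv.Perm M, ∀ a b, R a b ↔ b = σ a := by
  classical
  -- powers
  have hpow : ∀ R ∈ S, ∀ σ : Equiv.Perm M, (∀ a, R a (σ a)) → ∀ k : ℕ,
      ∃ Q ∈ S, ∀ a, Q a ((σ ^ (k + 1)) a) := by
    intro R hR σ hσ k
    induction k with
    | zero => exact ⟨R, hR, by simpa using hσ⟩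
    | succ k ih =>
      obtain ⟨Q, hQ, h⟩ := ih
      obtain ⟨Q', hQ', h'⟩ := hcomp Q hQ R hR
      refine ⟨Q', hQ', fun a => h' _ _ _ (h a) ?_⟩
      have := hσ ((σ ^ (k + 1)) a)
      rwa [← Equiv.Perm.mul_apply, ← pow_succ'] at this
  have hfin : ∀ σ : Equiv.Perm M, ∃ k : ℕ, σ ^ (k + 1) = 1 := by
    intro σ
    have := orderOf_pos σ
    exact ⟨orderOf σ - 1, by rw [Nat.sub_add_cancel this, pow_orderOf_eq_one]⟩
  have hinv : ∀ R ∈ S, ∀ σ : Equiv.Perm M, (∀ a, R a (σ a)) → ∃ Q ∈ S, ∀ a, Q a (σ⁻¹ a) := by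
    intro R hR σ hσ
    obtain ⟨k, hk⟩ := hfin σ
    obtain ⟨Q, hQ, h⟩ := hpow R hR σ hσ (2 * k)
    refine ⟨Q, hQ, ?_⟩
    have : σ ^ (2 * k + 1) = σ⁻¹ := by
      rw [eq_inv_iff_mul_eq_one, ← pow_succ, show 2 * k + 1 + 1 = (k + 1) * 2 by ring, pow_mul, hk,
        one_pow]
    rwa [this] at h
  intro R hR
  -- the greatest reflexive element
  let I : Set (M → M → Prop) := {Z | Z ∈ S ∧ ∀ a, Z a a}
  have hIne : I.Nonempty := by
    obtain ⟨σ, hσ⟩ := hperm R hR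
    obtain ⟨k, hk⟩ := hfin σ
    obtain ⟨Q, hQ, h⟩ := hpow R hR σ hσ k
    exact ⟨Q, hQ, by simpa [hk] using h⟩
  obtain ⟨Z, hZ⟩ := (Set.toFinite I).exists_maximal hIne
  have hZS := hZ.1.1
  have hZr := hZ.1.2
  have hgr : ∀ Q ∈ S, (∀ a, Q a a) → ∀ a b, Q a b → Z a b := by
    intro Q hQ hQr a b hab
    obtain ⟨Q', hQ', h'⟩ := hcomp Z hZS Q hQ
    have hle : Z ≤ Q' := fun a b h => h' _ _ _ h (hQr b)
    have := hZ.2 (show Q' ∈ I from ⟨hQ', fun a => h' _ _ _ (hZr a) (hQr a)⟩) hle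
    exact this a b (h' _ _ _ (hZr a) hab)
  have hZt : ∀ a b c, Z a b → Z b c → Z a c := by
    intro a b c h1 h2
    obtain ⟨Q', hQ', h'⟩ := hcomp Z hZS Z hZS
    exact hgr Q' hQ' (fun a => h' _ _ _ (hZr a) (hZr a)) _ _ (h' _ _ _ h1 h2)
  have hQZ : ∀ Q ∈ S, ∀ τ : Equiv.Perm M, (∀ a, Q a (τ a)) → ∀ a b, Q a b → Z a (τ⁻¹ b) := by
    intro Q hQ τ hτ a b hab
    obtain ⟨Q1, hQ1, h1⟩ := hinv Q hQ τ hτ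
    obtain ⟨Q2, hQ2, h2⟩ := hcomp Q hQ Q1 hQ1
    refine hgr Q2 hQ2 (fun a => ?_) _ _ (h2 _ _ _ hab (h1 b))
    simpa using h2 _ _ _ (hτ a) (h1 (τ a))
  have hconj : ∀ Q ∈ S, ∀ τ : Equiv.Perm M, (∀ a, Q a (τ a)) → ∀ a b, Z a b →
      Z (τ⁻¹ a) (τ⁻¹ b) := by
    intro Q hQ τ hτ a b hab
    obtain ⟨Q2, hQ2, h2⟩ := hcomp Q hQ Z hZS
    refine hQZ Q2 hQ2 τ (fun a => h2 _ _ _ (hτ a) (hZr _)) _ _ (h2 _ a _ ?_ hab)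
    simpa using hτ (τ⁻¹ a)
  have hZeq : ∀ e g, Z e g → e = g := by
    intro e g heg
    obtain ⟨Q, hQ, hge⟩ := htrans g e
    obtain ⟨τ, hτ⟩ := hperm Q hQ
    have h1 := hQZ Q hQ τ hτ _ _ hge
    have h2 : Z e (τ⁻¹ e) := hZt _ _ _ heg h1
    have h3 : ∀ j : ℕ, Z (τ⁻¹ e) ((τ⁻¹ ^ (j + 1)) e) := by
      intro j
      induction j with
      | zero => simpa using hZr _
      | succ j ih =>
        have := hconj Q hQ τ hτ _ _ (hZt _ _ _ h2 ih)
        rwa [← Equiv.Perm.mul_apply, ← pow_succ'] at this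
    obtain ⟨k, hk⟩ := hfin τ⁻¹
    have h4 := h3 k
    rw [hk] at h4
    exact hmerge Z hZS hZr hZt e g heg (hZt _ _ _ h1 h4)
  obtain ⟨σ, hσ⟩ := hperm R hR
  refine ⟨σ, fun a b => ⟨fun h => ?_, fun h => h ▸ hσ a⟩⟩
  have := hZeq _ _ (hQZ R hR σ hσ _ _ h)
  rw [this]; simp

end abstr

section classes
variable {X : Set (ℤ → A)} {Y : Set (ℤ → B)} {Φ : A → B}

lemma trans_of_pth (hS : Setup X Y Φ) {z : ℤ → B} {x x' : ℤ → A} (hx : x ∈ X) (hx' : x' ∈ X)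
    (e : ∀ i, Φ (x i) = z i) (e' : ∀ i, Φ (x' i) = z i)
    (h : ∀ n : ℤ, ∃ s t, n ≤ s ∧ s ≤ t ∧ Pth X Φ z s t (x s) (x' t)) :
    TransitionTo X (fun x i => Φ (x i)) x x' := by
  intro n
  obtain ⟨s, t, h1, h2, h3⟩ := h n
  obtain ⟨v, hv, v1, v2, v3⟩ := splice hS hx hx' e e' h2 h3
  exact ⟨v, hv, by funext i; simp [v1, e], fun m hm => v2 m (hm.trans h1), t, h1.trans h2, v3⟩

lemma pth_of_trans {z : ℤ → B} {x x' : ℤ → A}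
    (e : ∀ i, Φ (x i) = z i) 
    (h : TransitionTo X (fun x i => Φ (x i)) x x') (n : ℤ) :
    ∃ t, n ≤ t ∧ ∀ r, t ≤ r → Pth X Φ z n r (x n) (x' r) := by
  obtain ⟨v, hv, v1, v2, t, v3, v4⟩ := h n
  refine ⟨t, v3, fun r hr => ?_⟩
  rw [← v2 n le_rfl, ← v4 r hr]
  exact Pth.self hv (fun i _ _ => by rw [← e i]; exact congrFun v1 i)

lemma trans_refl {x : ℤ → A} (hx : x ∈ X) : TransEquiv X (fun x i => Φ (x i)) x x :=
  ⟨fun n => ⟨x, hx, rfl, fun _ _ => rfl, n, le_rfl, fun _ _ => rfl⟩,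
   fun n => ⟨x, hx, rfl, fun _ _ => rfl, n, le_rfl, fun _ _ => rfl⟩⟩

lemma trans_trans (hS : Setup X Y Φ) {z : ℤ → B} {x x' x'' : ℤ → A} (hx : x ∈ X)
    (hx'' : x'' ∈ X)
    (e : ∀ i, Φ (x i) = z i) (e' : ∀ i, Φ (x' i) = z i) (e'' : ∀ i, Φ (x'' i) = z i)
    (h : TransitionTo X (fun x i => Φ (x i)) x x')
    (h' : TransitionTo X (fun x i => Φ (x i)) x' x'') :
    TransitionTo X (fun x i => Φ (x i)) x x'' := by
  refine trans_of_pth hS hx hx'' e e'' fun n => ?_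
  obtain ⟨t, h1, h2⟩ := pth_of_trans e h n
  obtain ⟨r, h3, h4⟩ := pth_of_trans e' h' t
  exact ⟨n, r, le_rfl, by omega, (h2 t le_rfl).trans hS (h4 r le_rfl) h1 h3⟩

lemma class_eq (hS : Setup X Y Φ) {z : ℤ → B} {x x' : ℤ → A} (hx : x ∈ X) (hx' : x' ∈ X)
    (e : ∀ i, Φ (x i) = z i) (e' : ∀ i, Φ (x' i) = z i)
    (h : TransEquiv X (fun x i => Φ (x i)) x x') :
    transClass X (fun x i => Φ (x i)) x = transClass X (fun x i => Φ (x i)) x' := by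
  have hz : (fun i => Φ (x i)) = z := funext e
  have hz' : (fun i => Φ (x' i)) = z := funext e'
  ext v
  simp only [transClass, mem_ofPred_eq, hz, hz']
  constructor
  · rintro ⟨hv, ev, h1, h2⟩
    exact ⟨hv, ev, trans_trans hS hx' hv e' e (congrFun ev) h.2 h1,
      trans_trans hS hv hx' (congrFun ev) e e' h2 h.1⟩
  · rintro ⟨hv, ev, h1, h2⟩
    exact ⟨hv, ev, trans_trans hS hx hv e e' (congrFun ev) h.1 h1,
      trans_trans hS hv hx (congrFun ev) e' e h2 h.2⟩

lemma class_rep {z : ℤ → B} (D : transClassesOver X (fun x i => Φ (x i)) z) :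
    ∃ x ∈ X, (∀ i, Φ (x i) = z i) ∧ (D : Set (ℤ → A)) = transClass X (fun x i => Φ (x i)) x := by
  obtain ⟨x, hx, h1, h2⟩ := D.2
  exact ⟨x, hx, congrFun h1, h2⟩

open Filter in
lemma classes_finite [Finite A] (hS : Setup X Y Φ) (z : ℤ → B) :
    Finite (transClassesOver X (fun x i => Φ (x i)) z) := by
  by_contra hinf
  rw [not_finite_iff_infinite] at hinf
  let f := Infinite.natEmbedding (transClassesOver X (fun x i => Φ (x i)) z)
  choose r hr1 hr2 hr3 using fun D => class_rep (X := X) (Φ := Φ) (z := z) D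
  have key : ∀ i j : Fin (Nat.card A + 1), i ≠ j →
      ∀ᶠ n : ℤ in atTop, r (f i) n ≠ r (f j) n := by
    intro i j hij
    by_contra hcon
    rw [not_eventually] at hcon
    have h0 : ∀ n : ℤ, ∃ s, n ≤ s ∧ r (f i) s = r (f j) s := by
      intro n
      obtain ⟨s, h1, h2⟩ := frequently_atTop.1 hcon n
      exact ⟨s, h1, not_not.1 h2⟩
    have hE : TransEquiv X (fun x i => Φ (x i)) (r (f i)) (r (f j)) := by
      constructor
      · refine trans_of_pth hS (hr1 _) (hr1 _) (hr2 _) (hr2 _) fun n => ?_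
        obtain ⟨s, h1, h2⟩ := h0 n
        exact ⟨s, s, h1, le_rfl, h2 ▸ Pth.self (hr1 _) fun i _ _ => hr2 _ i⟩
      · refine trans_of_pth hS (hr1 _) (hr1 _) (hr2 _) (hr2 _) fun n => ?_
        obtain ⟨s, h1, h2⟩ := h0 n
        exact ⟨s, s, h1, le_rfl, h2 ▸ Pth.self (hr1 _) fun i _ _ => hr2 _ i⟩
    have := class_eq hS (hr1 _) (hr1 _) (hr2 _) (hr2 _) hE
    rw [← hr3, ← hr3] at this
    have := f.injective (Subtype.ext this)
    exact hij (Fin.ext this)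
  have key2 : ∀ᶠ n : ℤ in atTop, ∀ i j : Fin (Nat.card A + 1), i ≠ j → r (f i) n ≠ r (f j) n := by
    simp only [eventually_all]
    exact key
  obtain ⟨n, hn⟩ := key2.exists
  have hinj : Function.Injective (fun i : Fin (Nat.card A + 1) => r (f i) n) := by
    intro i j h
    by_contra hne
    exact hn i j hne h
  have := Nat.card_le_card_of_injective _ hinj
  simp at this

end classes
section core
variable {X : Set (ℤ → A)} {Y : Set (ℤ → B)} {Φ : A → B}

lemma Pth.mid (hS : Setup X Y Φ) {y : ℤ → B} {s t r : ℤ} {a b c : A}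
    (h1 : Pth X Φ y s t a b) (h2 : Pth X Φ y t r b c) :
    ∃ x ∈ X, x t = b ∧ ∀ i, s ≤ i → i ≤ r → Φ (x i) = y i := by
  obtain ⟨x, hx, rfl, rfl, h⟩ := h1
  obtain ⟨x', hx', e, rfl, h'⟩ := h2
  refine ⟨_, hS.glue x hx x' hx' t e.symm, by simp, ?_⟩
  intro i h1 h2
  by_cases hi : i ≤ t
  · simp [hi, h i h1 hi]
  · simp [hi, h' i (by omega) h2]

open Filter in
lemma used [Finite A] (hS : Setup X Y Φ) {y0 : ℤ → B} {L : ℕ} {M : Set A}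
    (hM : MinTB X Y Φ y0 L M) (z : ℤ → B)
    (hc : M.ncard ≤ Nat.card (transClassesOver X (fun x i => Φ (x i)) z)) :
    ∃ r : transClassesOver X (fun x i => Φ (x i)) z → ℤ → A,
      (∀ D, r D ∈ X) ∧ (∀ D i, Φ (r D i) = z i) ∧ ∃ H : ℤ, ∀ m, H ≤ m → Occ y0 L z m →
        ∃ g : transClassesOver X (fun x i => Φ (x i)) z ≃ M, ∀ D, Conn X Φ z L (r D) m (g D) := by
  have := classes_finite (A := A) hS z
  choose r hr1 hr2 hr3 using fun D => class_rep (X := X) (Φ := Φ) (z := z) D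
  refine ⟨r, hr1, hr2, ?_⟩
  have key : ∀ D D' : transClassesOver X (fun x i => Φ (x i)) z, D ≠ D' →
      ∀ᶠ m : ℤ in atTop, ∀ a, Conn X Φ z L (r D) m a → ¬ Conn X Φ z L (r D') m a := by
    intro D D' hne
    by_contra hcon
    rw [not_eventually] at hcon
    have h0 : ∀ n : ℤ, ∃ s, n ≤ s ∧ ∃ a, Conn X Φ z L (r D) s a ∧ Conn X Φ z L (r D') s a := by
      intro n
      obtain ⟨s, h1, h2⟩ := frequently_atTop.1 hcon n
      push Not at h2
      exact ⟨s, h1, h2⟩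
    have hE : TransEquiv X (fun x i => Φ (x i)) (r D) (r D') := by
      constructor
      · refine trans_of_pth hS (hr1 _) (hr1 _) (hr2 _) (hr2 _) fun n => ?_
        obtain ⟨s, h1, a, h2, h3⟩ := h0 (n + L)
        exact ⟨s - L, s + L, by omega, by omega, h2.1.trans hS h3.2 (by omega) (by omega)⟩
      · refine trans_of_pth hS (hr1 _) (hr1 _) (hr2 _) (hr2 _) fun n => ?_
        obtain ⟨s, h1, a, h2, h3⟩ := h0 (n + L)
        exact ⟨s - L, s + L, by omega, by omega, h3.1.trans hS h2.2 (by omega) (by omega)⟩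
    have := class_eq hS (hr1 _) (hr1 _) (hr2 _) (hr2 _) hE
    rw [← hr3, ← hr3] at this
    exact hne (Subtype.ext this)
  have key2 : ∀ᶠ m : ℤ in atTop, ∀ D D' : transClassesOver X (fun x i => Φ (x i)) z, D ≠ D' →
      ∀ a, Conn X Φ z L (r D) m a → ¬ Conn X Φ z L (r D') m a := by
    rw [eventually_all]; intro D
    rw [eventually_all]; intro D'
    rw [eventually_all]; exact key D D'
  obtain ⟨H, hH⟩ := eventually_atTop.1 key2
  refine ⟨H, fun m hm ho => ?_⟩
  choose g hg1 hg2 using fun D => ho.tb hS hM.tb (r D) (hr1 D) (fun i _ _ => hr2 D i)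
  have hinj : Function.Injective (fun D => (⟨g D, hg1 D⟩ : M)) := by
    intro D D' h
    by_contra hne
    have h' : g D = g D' := congrArg Subtype.val h
    exact hH m hm D D' hne _ (hg2 D) (h' ▸ hg2 D')
  have hb := hinj.bijective_of_nat_card_le (by simpa [Nat.card_coe_set_eq] using hc)
  exact ⟨Equiv.ofBijective _ hb, fun D => hg2 D⟩

lemma ext_pt [Finite A] (hS : Setup X Y Φ) {y0 : ℤ → B} {L : ℕ} {M : Set A}
    (hM : MinTB X Y Φ y0 L M) {z : ℤ → B} (hz : RightTransitive Y z)
    (hc : M.ncard ≤ Nat.card (transClassesOver X (fun x i => Φ (x i)) z))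
    {y : ℤ → B} (hy : y ∈ Y) {n : ℤ} (ho : Occ y0 L y n) {f : A} (hf : f ∈ M) (K : ℕ) :
    ∃ x ∈ X, x n = f ∧ ∀ i, n - K ≤ i → i ≤ n + K → Φ (x i) = y i := by
  obtain ⟨r, hr1, hr2, H, hH⟩ := used hS hM z hc
  obtain ⟨h, h1, h2⟩ := rt_occ hS hz hy (H - n) (n.natAbs + K + L)
  obtain ⟨g, hg⟩ := hH (n + h) (by omega) (by
    intro i i1 i2
    rw [← add_assoc, h2 _ (by omega) (by omega), ho i i1 i2])
  obtain ⟨D, hD⟩ := g.surjective ⟨f, hf⟩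
  have hDf := hg D
  rw [hD] at hDf
  obtain ⟨x, hx, x1, x2⟩ := Pth.mid hS
    ((Pth.self (hr1 D) (s := n + h - L - K) (t := n + h - L) (fun i _ _ => hr2 D i)).trans hS hDf.1
      (by omega) (by omega))
    (hDf.2.trans hS (Pth.self (hr1 D) (s := n + h + L) (t := n + h + L + K) (fun i _ _ => hr2 D i))
      (by omega) (by omega))
  refine ⟨_, hS.shX h x hx, x1, fun i i1 i2 => ?_⟩
  rw [x2 _ (by omega) (by omega), h2 _ (by omega) (by omega)]

lemma has_perm [Finite A] (hS : Setup X Y Φ) {y0 : ℤ → B} {L : ℕ} {M : Set A}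
    (hM : MinTB X Y Φ y0 L M) {z : ℤ → B} (hz : RightTransitive Y z)
    (hc : M.ncard ≤ Nat.card (transClassesOver X (fun x i => Φ (x i)) z))
    {y : ℤ → B} (hy : y ∈ Y) {m n : ℤ} (hmn : m + 2 * L ≤ n) (hm : Occ y0 L y m)
    (hn : Occ y0 L y n) : ∃ σ : Equiv.Perm M, ∀ e : M, Pth X Φ y m n e (σ e) := by
  obtain ⟨r, hr1, hr2, H, hH⟩ := used hS hM z hc
  obtain ⟨h, h1, h2⟩ := rt_occ hS hz hy (H - m) (n.natAbs + m.natAbs + L)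
  obtain ⟨g, hg⟩ := hH (m + h) (by omega) (by
    intro i i1 i2
    rw [← add_assoc, h2 _ (by omega) (by omega), hm i i1 i2])
  obtain ⟨g', hg'⟩ := hH (n + h) (by omega) (by
    intro i i1 i2
    rw [← add_assoc, h2 _ (by omega) (by omega), hn i i1 i2])
  refine ⟨g.symm.trans g', fun e => ?_⟩
  obtain ⟨D, rfl⟩ := g.surjective e
  have := Conn.path hS (hr1 D) (by omega) (fun i _ _ => hr2 D i) (hg D) (hg' D)
  simp only [Equiv.trans_apply, Equiv.symm_apply_apply]
  refine this.shift hS (-h) (by ring) (by ring) fun i i1 i2 => ?_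
  rw [← h2 _ (by omega) (by omega)]; simp

lemma glue_words [Finite A] (hS : Setup X Y Φ) {y0 : ℤ → B} {L : ℕ} {M : Set A}
    (hM : MinTB X Y Φ y0 L M) {z : ℤ → B} (hz : RightTransitive Y z)
    (hc : M.ncard ≤ Nat.card (transClassesOver X (fun x i => Φ (x i)) z))
    {y y' : ℤ → B} (hy : y ∈ Y) (hy' : y' ∈ Y) {n m' : ℤ} (hn : Occ y0 L y n)
    (hm' : Occ y0 L y' m') (K : ℕ) :
    ∃ v ∈ Y, (∀ i, n - K ≤ i → i ≤ n + L → v i = y i) ∧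
      (∀ i, m' - L ≤ i → i ≤ m' + K → v (i + (n - m')) = y' i) := by
  obtain ⟨x0, hx0, e0⟩ := hS.surj y0 hM.mem
  obtain ⟨f, hf, -⟩ := hM.tb x0 hx0 (fun i _ _ => congrFun e0 i)
  obtain ⟨x, hx, x1, x2⟩ := ext_pt hS hM hz hc hy hn hf (K + L)
  obtain ⟨x', hx', x1', x2'⟩ := ext_pt hS hM hz hc hy' hm' hf (K + L)
  have hg := hS.glue x hx _ (hS.shX (m' - n) x' hx') n (by simp [x1, x1'])
  have a1 : ∀ i, n - K - L ≤ i → i ≤ n → Φ (if i ≤ n then x i else x' (i + (m' - n))) = y i := by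
    intro i i1 i2
    rw [if_pos i2, x2 i (by omega) (by omega)]
  have a2 : ∀ i, n < i → i ≤ n + K + L →
      Φ (if i ≤ n then x i else x' (i + (m' - n))) = y' (i + (m' - n)) := by
    intro i i1 i2
    rw [if_neg (by omega), x2' _ (by omega) (by omega)]
  have a3 : ∀ i, n - L ≤ i → i ≤ n + L → y i = y' (i + (m' - n)) := by
    intro i i1 i2
    have b1 := hn (i - n) (by omega) (by omega)
    have b2 := hm' (i - n) (by omega) (by omega)
    rw [← b2] at b1
    rw [show i + (m' - n) = i - n + m' by ring, ← b1]; simp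
  refine ⟨_, hS.img _ hg, fun i i1 i2 => ?_, fun i i1 i2 => ?_⟩
  · by_cases h : i ≤ n
    · exact a1 i (by omega) h
    · exact (a2 i (by omega) (by omega)).trans (a3 i (by omega) (by omega)).symm
  · by_cases h : i + (n - m') ≤ n
    · refine (a1 _ (by omega) h).trans ((a3 _ (by omega) (by omega)).trans ?_)
      congr 1; ring
    · refine (a2 _ (by omega) (by omega)).trans ?_
      congr 1; ring

lemma core [Finite A] (hS : Setup X Y Φ) {y0 : ℤ → B} {L : ℕ} {M : Set A}
    (hM : MinTB X Y Φ y0 L M) {z : ℤ → B} (hz : RightTransitive Y z)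
    (hc : M.ncard ≤ Nat.card (transClassesOver X (fun x i => Φ (x i)) z))
    [TopologicalSpace A] (hirr : IrreducibleSubshift X)
    {y : ℤ → B} (hy : y ∈ Y) {m n : ℤ} (hmn : m + 2 * L ≤ n) (hm : Occ y0 L y m)
    (hn : Occ y0 L y n) :
    ∃ σ : Equiv.Perm M, ∀ e f : M, Pth X Φ y m n e f ↔ f = σ e := by
  let S : Set (M → M → Prop) := {R | ∃ y ∈ Y, ∃ m n : ℤ, m + 2 * L ≤ n ∧ Occ y0 L y m ∧
    Occ y0 L y n ∧ R = fun e f : M => Pth X Φ y m n e f}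
  refine abstract_core S ?_ ?_ ?_ ?_ _ ⟨y, hy, m, n, hmn, hm, hn, rfl⟩
  · rintro _ ⟨y, hy, m, n, hmn, hm, hn, rfl⟩ _ ⟨y', hy', m', n', hmn', hm', hn', rfl⟩
    obtain ⟨v, hv, v1, v2⟩ := glue_words hS hM hz hc hy hy' hn hm' ((n - m).natAbs + (n' - m').natAbs + L)
    refine ⟨_, ⟨v, hv, m, n' + (n - m'), by omega, ?_, ?_, rfl⟩, ?_⟩
    · intro i i1 i2
      rw [v1 _ (by omega) (by omega), hm i i1 i2]
    · intro i i1 i2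
      rw [← add_assoc, v2 _ (by omega) (by omega), hn' i i1 i2]
    · intro a b c hab hbc
      refine Pth.trans hS (t := n) (hab.congr fun i i1 i2 => v1 i (by omega) (by omega))
        (hbc.shift hS (n - m') (by ring) (by ring) fun i i1 i2 => v2 i (by omega) (by omega))
        (by omega) (by omega)
  · rintro _ ⟨y, hy, m, n, hmn, hm, hn, rfl⟩
    exact has_perm hS hM hz hc hy hmn hm hn
  · intro e f
    have ho : Occ y0 L y0 0 := fun i _ _ => by simp
    obtain ⟨x, hx, x1, x2⟩ := ext_pt hS hM hz hc hM.mem ho e.2 L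
    obtain ⟨x', hx', x1', x2'⟩ := ext_pt hS hM hz hc hM.mem ho f.2 L
    obtain ⟨v, hv, i, k, hik, hi, hk⟩ := hirr (2 * L + 1) (2 * L + 1)
      (fun j => x (-L + (j.1 : ℤ))) (fun j => x' (-L + (j.1 : ℤ)))
      ⟨x, hx, -L, fun _ => rfl⟩ ⟨x', hx', -L, fun _ => rfl⟩
    have hi' : ∀ t : ℤ, -(L : ℤ) ≤ t → t ≤ L → v (t + (i + L)) = x t := by
      intro t t1 t2
      have := hi ⟨(t + L).toNat, by omega⟩
      simp only [Int.toNat_of_nonneg (show 0 ≤ t + L by omega)] at this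
      rw [show t + (i + L) = i + (t + L) by ring, this]; congr 1; ring
    have hk' : ∀ t : ℤ, -(L : ℤ) ≤ t → t ≤ L → v (t + (k + L)) = x' t := by
      intro t t1 t2
      have := hk ⟨(t + L).toNat, by omega⟩
      simp only [Int.toNat_of_nonneg (show 0 ≤ t + L by omega)] at this
      rw [show t + (k + L) = k + (t + L) by ring, this]; congr 1; ring
    push_cast at hik
    refine ⟨_, ⟨_, hS.img v hv, i + L, k + L, by omega, ?_, ?_, rfl⟩, ?_⟩
    · intro t t1 t2
      simp only [hi' t t1 t2]
      exact x2 t (by omega) (by omega)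
    · intro t t1 t2
      simp only [hk' t t1 t2]
      exact x2' t (by omega) (by omega)
    · refine ⟨v, hv, ?_, ?_, fun _ _ _ => rfl⟩
      · have := hi' 0 (by omega) (by omega)
        rwa [x1, zero_add] at this
      · have := hk' 0 (by omega) (by omega)
        rwa [x1', zero_add] at this
  · rintro _ ⟨y, hy, m, n, hmn, hm, hn, rfl⟩ hrefl htr a b hab hba
    by_contra hne
    obtain ⟨v, hv, v1, v2⟩ := glue_words hS hM hz hc hy hy hn hm ((n - m).natAbs + L)
    set n2 := n + (n - m) with hn2
    have om : Occ y0 L v m := by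
      intro i i1 i2
      rw [v1 _ (by omega) (by omega), hm i i1 i2]
    have on : Occ y0 L v n := by
      intro i i1 i2
      rw [v1 _ (by omega) (by omega), hn i i1 i2]
    have on2 : Occ y0 L v n2 := by
      intro i i1 i2
      rw [hn2, ← add_assoc, v2 _ (by omega) (by omega), hn i i1 i2]
    have p1 : ∀ e f : A, Pth X Φ y m n e f ↔ Pth X Φ v m n e f := fun e f =>
      ⟨fun h => h.congr fun i i1 i2 => v1 i (by omega) (by omega),
       fun h => h.congr fun i i1 i2 => (v1 i (by omega) (by omega)).symm⟩
    have p2 : ∀ e f : A, Pth X Φ y m n e f ↔ Pth X Φ v n n2 e f := fun e f =>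
      ⟨fun h => h.shift hS (n - m) (by omega) (by omega)
          fun i i1 i2 => v2 i (by omega) (by omega),
       fun h => h.shift hS (m - n) (by omega) (by omega) fun i i1 i2 => by
          rw [← v2 _ (by omega) (by omega)]; congr 1; ring⟩
    set K : ℕ := (n - m).natAbs + L with hK
    have htb : TBat X Φ v n K (M \ {(b : A)}) := by
      intro x hx hxv
      obtain ⟨m0, hm0, c0⟩ := om.tb hS hM.tb x hx (fun i _ _ => hxv i (by omega) (by omega))
      obtain ⟨m1, hm1, c1⟩ := on.tb hS hM.tb x hx (fun i _ _ => hxv i (by omega) (by omega))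
      obtain ⟨m2, hm2, c2⟩ := on2.tb hS hM.tb x hx (fun i _ _ => hxv i (by omega) (by omega))
      have q1 := Conn.path hS hx hmn (fun i _ _ => hxv i (by omega) (by omega)) c0 c1
      have q2 := Conn.path hS hx (by omega) (fun i _ _ => hxv i (by omega) (by omega)) c1 c2
      have fin : ∀ s, s ∈ M → s ≠ b → Pth X Φ v m n m0 s → Pth X Φ v n n2 s m2 →
          ∃ a ∈ M \ {(b : A)}, Conn X Φ v K x n a := by
        intro s hs hsb r1 r2
        refine ⟨s, ⟨hs, hsb⟩, ?_, ?_⟩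
        · refine Pth.trans hS ?_ r1 (by omega) (by omega)
          have := c0.1
          rwa [show m - L = n - K by omega] at this
        · refine Pth.trans hS r2 ?_ (by omega) (by omega)
          have := c2.2
          rwa [show n2 + L = n + K by omega] at this
      by_cases hb : m1 = b
      · refine fin a a.2 (fun h => hne (Subtype.ext h)) ?_ ?_
        · rw [← p1]
          refine htr ⟨m0, hm0⟩ b a ?_ hba
          exact (p1 _ _).2 (hb ▸ q1)
        · rw [← p2]
          refine htr a b ⟨m2, hm2⟩ hab ?_
          exact (p2 _ _).2 (hb ▸ q2)
      · exact fin m1 hm1 hb q1 q2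
    have htb0 : TBat X Φ (fun i => v (i + n)) 0 K (M \ {(b : A)}) := by
      refine Occ.tb hS (y0 := fun i => v (i + n)) (y := fun i => v (i + n)) (m := 0) (by intro i _ _; simp) ?_
      intro x hx hxv
      obtain ⟨s, hs, h1, h2⟩ := htb _ (hS.shX (-n) x hx) (by
        intro i i1 i2
        rw [hxv _ (by omega) (by omega)]; simp)
      refine ⟨s, hs, ?_, ?_⟩
      · have := h1.shift hS (y' := fun i => v (i + n)) (s' := 0 - K) (t' := 0) (-n) (by ring) (by ring) (fun i _ _ => by simp)
        convert this using 2; ring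
      · have := h2.shift hS (y' := fun i => v (i + n)) (s' := 0) (t' := 0 + K) (-n) (by ring) (by ring) (fun i _ _ => by simp)
        convert this using 2; ring
    have hmin := hM.min _ (hS.shY n v hv) K _ htb0
    have := Set.ncard_sdiff_singleton_lt_of_mem b.2 (Set.toFinite M)
    omega

end core
section final
variable {X : Set (ℤ → A)} {Y : Set (ℤ → B)} {Φ : A → B}

open Filter in
/-- Every point of `Y` produces a transition block whose depth is at most its number of classes. -/
lemma exists_tb [Finite A] [TopologicalSpace A] [DiscreteTopology A] (hS : Setup X Y Φ)
    (hcl : IsClosed X) {y : ℤ → B} (hy : y ∈ Y) :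
    ∃ v ∈ Y, ∃ (L : ℕ) (M : Set A), TBat X Φ v 0 L M ∧
      M.ncard ≤ Nat.card (transClassesOver X (fun x i => Φ (x i)) y) := by
  have hfin := classes_finite (A := A) hS y
  choose r hr1 hr2 hr3 using fun D => class_rep (X := X) (Φ := Φ) (z := y) D
  have key : ∀ (a : A) (D : transClassesOver X (fun x i => Φ (x i)) y), ∀ᶠ n : ℕ in atTop,
      (∃ x ∈ (D : Set (ℤ → A)), x 0 = a) → Pth X Φ y 0 n a (r D n) := by
    intro a D
    by_cases h : ∃ x ∈ (D : Set (ℤ → A)), x 0 = a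
    · obtain ⟨x, hx, rfl⟩ := h
      rw [hr3] at hx
      obtain ⟨hxX, hxe, -, hx2⟩ := hx
      have ex : ∀ i, Φ (x i) = y i := fun i => (congrFun hxe i).trans (hr2 D i)
      obtain ⟨t, ht, h⟩ := pth_of_trans ex hx2 0
      filter_upwards [eventually_ge_atTop t.toNat] with n hn _
      exact h n (by omega)
    · exact Eventually.of_forall fun n hh => absurd hh h
  have key2 : ∀ᶠ n : ℕ in atTop, ∀ (a : A) (D : transClassesOver X (fun x i => Φ (x i)) y),
      (∃ x ∈ (D : Set (ℤ → A)), x 0 = a) → Pth X Φ y 0 n a (r D n) := by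
    rw [eventually_all]; intro a
    rw [eventually_all]; exact key a
  obtain ⟨n, hn⟩ := key2.exists
  let G : ℕ → Set (ℤ → A) := fun j => {x | x ∈ X ∧
    (∀ i : ℤ, -((n + j : ℕ) : ℤ) ≤ i → i ≤ (n + j : ℕ) → Φ (x i) = y i) ∧
    ¬ ∃ D, Pth X Φ y 0 n (x 0) (r D n) ∧ Pth X Φ y n (n + j : ℕ) (r D n) (x (n + j : ℕ))}
  have hG : ∃ j, G j = ∅ := by
    by_contra hcon
    push Not at hcon
    have hclG : ∀ j, IsClosed (G j) := by
      intro j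
      refine hcl.inter (IsClosed.inter ?_ ?_)
      · have : {x : ℤ → A | ∀ i : ℤ, -((n + j : ℕ) : ℤ) ≤ i → i ≤ (n + j : ℕ) → Φ (x i) = y i} =
          ⋂ i : ℤ, {x | -((n + j : ℕ) : ℤ) ≤ i → i ≤ (n + j : ℕ) → Φ (x i) = y i} := by
          ext; simp
        change IsClosed {x : ℤ → A | ∀ i : ℤ, -((n + j : ℕ) : ℤ) ≤ i → i ≤ (n + j : ℕ) → Φ (x i) = y i}
        rw [this]
        refine isClosed_iInter fun i => ?_
        have hcont : Continuous (fun x : ℤ → A => x i) := continuous_apply i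
        exact (isClosed_discrete {a : A | -((n + j : ℕ) : ℤ) ≤ i → i ≤ (n + j : ℕ) → Φ a = y i}).preimage
          hcont
      · have hcont : Continuous (fun x : ℤ → A => (x 0, x ((n + j : ℕ) : ℤ))) :=
          (continuous_apply (0 : ℤ)).prodMk (continuous_apply ((n + j : ℕ) : ℤ))
        exact (isClosed_discrete {a : A × A | ¬ ∃ D, Pth X Φ y 0 n a.1 (r D n) ∧
          Pth X Φ y n (n + j : ℕ) (r D n) a.2}).preimage
          hcont
    obtain ⟨x, hx⟩ := IsCompact.nonempty_iInter_of_sequence_nonempty_isCompact_isClosed G (by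
      rintro j x ⟨h1, h2, h3⟩
      refine ⟨h1, fun i i1 i2 => h2 i (by omega) (by omega), ?_⟩
      rintro ⟨D, d1, d2⟩
      refine h3 ⟨D, d1, d2.trans hS (Pth.self h1 fun i i1 i2 => h2 i (by omega) (by omega))
        (by omega) (by omega)⟩) hcon ((hclG 0).isCompact) hclG
    rw [mem_iInter] at hx
    have hxX := (hx 0).1
    have hxe : ∀ i, Φ (x i) = y i := fun i => (hx i.natAbs).2.1 i (by omega) (by omega)
    let D : transClassesOver X (fun x i => Φ (x i)) y :=
      ⟨transClass X (fun x i => Φ (x i)) x, x, hxX, funext hxe, rfl⟩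
    have hxD : x ∈ (D : Set (ℤ → A)) := ⟨hxX, rfl, trans_refl hxX⟩
    have h1 := hn (x 0) D ⟨x, hxD, rfl⟩
    rw [hr3] at hxD
    obtain ⟨t, ht, h⟩ := pth_of_trans (hr2 D) hxD.2.2.1 n
    exact (hx t.toNat).2.2 ⟨D, h1, h _ (by omega)⟩
  obtain ⟨j, hj⟩ := hG
  refine ⟨_, hS.shY n y hy, n + n + j, Set.range fun D => r D n, ?_, ?_⟩
  · intro x hx hxy
    have hx' := hS.shX (-n) x hx
    have hxy' : ∀ i : ℤ, -((n + j : ℕ) : ℤ) ≤ i → i ≤ n + n + n + j → Φ (x (i + -n)) = y i := by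
      intro i i1 i2
      rw [hxy _ (by omega) (by omega)]; simp
    have : (fun i => x (i + -n)) ∉ G j := by rw [hj]; simp
    have hD : ∃ D, Pth X Φ y 0 n (x (0 + -n)) (r D n) ∧
        Pth X Φ y n (n + j : ℕ) (r D n) (x ((n + j : ℕ) + -n)) := by
      by_contra hD
      exact this ⟨hx', fun i i1 i2 => hxy' i i1 (by omega), hD⟩
    obtain ⟨D, d1, d2⟩ := hD
    have q1 : Pth X Φ y (-((n + j : ℕ) : ℤ)) n (x (-((n + j : ℕ) : ℤ) + -n)) (r D n) :=
      (Pth.self hx' fun i i1 i2 => hxy' i (by omega) (by omega)).trans hS d1 (by omega) (by omega)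
    have q2 : Pth X Φ y n (n + n + n + j) (r D n) (x (n + n + n + j + -n)) :=
      d2.trans hS (Pth.self hx' fun i i1 i2 => hxy' i (by omega) (by omega)) (by omega) (by omega)
    refine ⟨r D n, ⟨D, rfl⟩, ?_, ?_⟩
    · have := q1.shift hS (y' := fun i => y (i + n)) (s' := 0 - (n + n + j : ℕ)) (t' := 0) (-n)
        (by push_cast; ring) (by ring) (fun i _ _ => by simp)
      convert this using 2; push_cast; ring
    · have := q2.shift hS (y' := fun i => y (i + n)) (s' := 0) (t' := 0 + (n + n + j : ℕ)) (-n)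
        (by ring) (by push_cast; ring) (fun i _ _ => by simp)
      convert this using 2; push_cast; ring
  · rw [← Nat.card_coe_set_eq]
    exact Finite.card_range_le _

lemma class_bij [Finite A] [TopologicalSpace A] (hS : Setup X Y Φ) {y0 : ℤ → B} {L : ℕ} {M : Set A}
    (hM : MinTB X Y Φ y0 L M) {z : ℤ → B} (hz : DoublyTransitive Y z)
    (hc : M.ncard ≤ Nat.card (transClassesOver X (fun x i => Φ (x i)) z))
    (hirr : IrreducibleSubshift X) {m : ℤ} (ho : Occ y0 L z m) :
    ∃ ρ : transClassesOver X (fun x i => Φ (x i)) z → M, Function.Bijective ρ ∧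
      ∀ D : transClassesOver X (fun x i => Φ (x i)) z, ∀ x ∈ (D : Set (ℤ → A)), Conn X Φ z L x m (ρ D) := by
  have hfin := classes_finite (A := A) hS z
  have hzY := hz.1.1
  choose r hr1 hr2 hr3 using fun D => class_rep (X := X) (Φ := Φ) (z := z) D
  have right : ∀ H : ℤ, ∃ h, H ≤ h ∧ Occ y0 L z h := fun H => rt_occ hS hz.1 hM.mem H L
  have hcore := fun {m n : ℤ} => core hS hM hz.1 hc hirr hzY (m := m) (n := n)
  -- equivalent points have the same routing
  have heq : ∀ x ∈ X, ∀ x' ∈ X, (∀ i, Φ (x i) = z i) → (∀ i, Φ (x' i) = z i) →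
      TransitionTo X (fun x i => Φ (x i)) x x' → ∀ f f' : M, Conn X Φ z L x m f →
      Conn X Φ z L x' m f' → f = f' := by
    intro x hx x' hx' e e' ht f f' hf hf'
    obtain ⟨t, ht1, ht2⟩ := pth_of_trans e ht (m + L)
    obtain ⟨h, h1, h2⟩ := right (t + L)
    obtain ⟨g, hg, cg⟩ := h2.tb hS hM.tb x' hx' (fun i _ _ => e' i)
    obtain ⟨σ, hσ⟩ := hcore (m := m) (n := h) (by omega) ho h2
    have a1 : Pth X Φ z m h f g := (hf.2.trans hS (ht2 (h - L) (by omega)) (by omega) (by omega)).trans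
      hS cg.1 (by omega) (by omega)
    have a2 : Pth X Φ z m h f' g := Conn.path hS hx' (by omega) (fun i _ _ => e' i) hf' cg
    have b1 := (hσ f ⟨g, hg⟩).1 a1
    have b2 := (hσ f' ⟨g, hg⟩).1 a2
    exact σ.injective (b1.symm.trans b2)
  choose g hg1 hg2 using fun D => ho.tb hS hM.tb (r D) (hr1 D) (fun i _ _ => hr2 D i)
  have hinj : Function.Injective (fun D => (⟨g D, hg1 D⟩ : M)) := by
    intro D D' h
    have hgg : g D = g D' := congrArg Subtype.val h
    have hE : ∀ n : ℤ, ∃ s, n ≤ s ∧ ∃ a, Conn X Φ z L (r D) s a ∧ Conn X Φ z L (r D') s a := by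
      intro n
      obtain ⟨h, h1, h2⟩ := right (max n (m + 2 * L))
      obtain ⟨b, hb, cb⟩ := h2.tb hS hM.tb (r D) (hr1 D) (fun i _ _ => hr2 D i)
      obtain ⟨b', hb', cb'⟩ := h2.tb hS hM.tb (r D') (hr1 D') (fun i _ _ => hr2 D' i)
      obtain ⟨σ, hσ⟩ := hcore (m := m) (n := h) (by omega) ho h2
      have a1 := Conn.path hS (hr1 D) (by omega) (fun i _ _ => hr2 D i) (hg2 D) cb
      have a2 := Conn.path hS (hr1 D') (by omega) (fun i _ _ => hr2 D' i) (hg2 D') cb'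
      rw [← hgg] at a2
      have b1 := (hσ ⟨g D, hg1 D⟩ ⟨b, hb⟩).1 a1
      have b2 := (hσ ⟨g D, hg1 D⟩ ⟨b', hb'⟩).1 a2
      have : b = b' := congrArg Subtype.val (b1.trans b2.symm)
      exact ⟨h, by omega, b, cb, this ▸ cb'⟩
    have hT : TransEquiv X (fun x i => Φ (x i)) (r D) (r D') := by
      constructor
      · refine trans_of_pth hS (hr1 _) (hr1 _) (hr2 _) (hr2 _) fun n => ?_
        obtain ⟨s, h1, a, h2, h3⟩ := hE (n + L)
        exact ⟨s - L, s + L, by omega, by omega, h2.1.trans hS h3.2 (by omega) (by omega)⟩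
      · refine trans_of_pth hS (hr1 _) (hr1 _) (hr2 _) (hr2 _) fun n => ?_
        obtain ⟨s, h1, a, h2, h3⟩ := hE (n + L)
        exact ⟨s - L, s + L, by omega, by omega, h3.1.trans hS h2.2 (by omega) (by omega)⟩
    have := class_eq hS (hr1 _) (hr1 _) (hr2 _) (hr2 _) hT
    rw [← hr3, ← hr3] at this
    exact Subtype.ext this
  have hb := hinj.bijective_of_nat_card_le (by simpa [Nat.card_coe_set_eq] using hc)
  refine ⟨_, hb, fun D x hx => ?_⟩
  rw [hr3] at hx
  obtain ⟨hxX, hxe, hx1, -⟩ := hx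
  have ex : ∀ i, Φ (x i) = z i := fun i => (congrFun hxe i).trans (hr2 D i)
  obtain ⟨f, hf, cf⟩ := ho.tb hS hM.tb x hxX (fun i _ _ => ex i)
  have := heq _ (hr1 D) x hxX (hr2 D) ex hx1 ⟨g D, hg1 D⟩ ⟨f, hf⟩ (hg2 D) cf
  rw [this]; exact cf

lemma magic_ext [Finite A] (hS : Setup X Y Φ) {p : ℕ} {w : Fin (p + 1) → B}
    (hw : IsMagicBlock X Y Φ w) :
    ∃ k : Fin (p + 1), ∀ y ∈ Y, ∀ i : ℤ, (∀ j : Fin (p + 1), y (i + (j.1 : ℤ)) = w j) →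
      ∀ u ∈ blockPre X Φ w, ∀ K : ℕ, ∃ x ∈ X, x (i + (k.1 : ℤ)) = u k ∧
        ∀ t, i - K ≤ t → t ≤ i + p + K → Φ (x t) = y t := by
  obtain ⟨k, hk⟩ : dval X Φ w ∈ {m | ∃ k : Fin (p + 1),
      Nat.card {a : A | ∃ u ∈ blockPre X Φ w, u k = a} = m} := Nat.sInf_mem ⟨_, 0, rfl⟩
  refine ⟨k, fun y hy i hi u hu K => ?_⟩
  let v : Fin (p + 2 * K + 1) → B := fun j => y (i - K + (j.1 : ℤ))
  have hv : OccursIn v Y := ⟨y, hy, i - K, fun _ => rfl⟩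
  let k' : Fin (p + 2 * K + 1) := ⟨K + k.1, by omega⟩
  have h1 : dval X Φ w ≤ dval X Φ v := by
    rw [hw.2]; exact Nat.sInf_le ⟨_, v, hv, rfl⟩
  have h2 : dval X Φ v ≤ Nat.card {a : A | ∃ u ∈ blockPre X Φ v, u k' = a} :=
    Nat.sInf_le ⟨k', rfl⟩
  have hsub : {a : A | ∃ u ∈ blockPre X Φ v, u k' = a} ⊆ {a : A | ∃ u ∈ blockPre X Φ w, u k = a} := by
    rintro _ ⟨u', ⟨⟨x, hx, s, hs⟩, hu'⟩, rfl⟩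
    refine ⟨fun j => u' ⟨K + j.1, by omega⟩, ⟨⟨x, hx, s + K, fun j => ?_⟩, fun j => ?_⟩, rfl⟩
    · show _ = u' _
      rw [← hs]; push_cast; congr 1; ring
    · rw [hu', ← hi j]; simp only [v]; push_cast; congr 1; ring
  have heq := Set.eq_of_subset_of_ncard_le hsub (by
    rw [← Nat.card_coe_set_eq, ← Nat.card_coe_set_eq]; omega) (Set.toFinite _)
  have hmem : u k ∈ {a : A | ∃ u ∈ blockPre X Φ v, u k' = a} := by rw [heq]; exact ⟨u, hu, rfl⟩
  obtain ⟨u', ⟨⟨x, hx, s, hs⟩, hu'⟩, huk⟩ := hmem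
  refine ⟨_, hS.shX (s - (i - K)) x hx, ?_, fun t t1 t2 => ?_⟩
  · rw [← huk, ← hs]; simp only [k']; push_cast; congr 1; ring
  · have a1 := hs ⟨(t - (i - K)).toNat, by omega⟩
    have a2 := hu' ⟨(t - (i - K)).toNat, by omega⟩
    rw [← a1] at a2
    simp only [v, Int.toNat_of_nonneg (show 0 ≤ t - (i - K) by omega)] at a2
    rw [show t + (s - (i - K)) = s + (t - (i - K)) by ring, a2]; congr 1; ring

end final
section assemble
variable {X : Set (ℤ → A)} {Y : Set (ℤ → B)} {Φ : A → B}

/-- What happens at an occurrence of the magic block between two transition blocks. -/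
lemma sandwich [Finite A] [TopologicalSpace A] (hS : Setup X Y Φ) {y0 : ℤ → B} {L : ℕ} {M : Set A}
    (hM : MinTB X Y Φ y0 L M) {z : ℤ → B} (hz : RightTransitive Y z)
    (hc : M.ncard ≤ Nat.card (transClassesOver X (fun x i => Φ (x i)) z))
    (hirr : IrreducibleSubshift X) {p : ℕ} {w : Fin (p + 1) → B} {k : Fin (p + 1)}
    (hk : ∀ y ∈ Y, ∀ i : ℤ, (∀ j : Fin (p + 1), y (i + (j.1 : ℤ)) = w j) →
      ∀ u ∈ blockPre X Φ w, ∀ K : ℕ, ∃ x ∈ X, x (i + (k.1 : ℤ)) = u k ∧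
        ∀ t, i - K ≤ t → t ≤ i + p + K → Φ (x t) = y t)
    {y : ℤ → B} (hy : y ∈ Y) {i m n : ℤ} (hi : ∀ j : Fin (p + 1), y (i + (j.1 : ℤ)) = w j)
    (hm : Occ y0 L y m) (hn : Occ y0 L y n) (hmi : m + L ≤ i) (hin : i + p + L ≤ n) :
    ∃ σ : Equiv.Perm M, ∀ u ∈ blockPre X Φ w,
      (∃ e : M, Pth X Φ y m (i + (k.1 : ℤ)) e (u k)) ∧
      (∃ f : M, Pth X Φ y (i + (k.1 : ℤ)) n (u k) f) ∧
      ∀ e f : M, Pth X Φ y m (i + (k.1 : ℤ)) e (u k) → Pth X Φ y (i + (k.1 : ℤ)) n (u k) f →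
        f = σ e := by
  obtain ⟨σ, hσ⟩ := core hS hM hz hc hirr hy (by omega) hm hn
  have hk2 := k.2
  refine ⟨σ, fun u hu => ?_⟩
  obtain ⟨x, hx, x1, x2⟩ := hk y hy i hi u hu ((n - m).natAbs + L)
  have hx' : ∀ t, m - L ≤ t → t ≤ n + L → Φ (x t) = y t := fun t t1 t2 => x2 t (by omega) (by omega)
  obtain ⟨e, he, ce⟩ := hm.tb hS hM.tb x hx (fun t _ _ => hx' t (by omega) (by omega))
  obtain ⟨f, hf, cf⟩ := hn.tb hS hM.tb x hx (fun t _ _ => hx' t (by omega) (by omega))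
  refine ⟨⟨⟨e, he⟩, ?_⟩, ⟨⟨f, hf⟩, ?_⟩, ?_⟩
  · rw [← x1]
    exact ce.2.trans hS (Pth.self hx fun t _ _ => hx' t (by omega) (by omega)) (by omega) (by omega)
  · rw [← x1]
    exact (Pth.self hx fun t _ _ => hx' t (by omega) (by omega)).trans hS cf.1 (by omega) (by omega)
  · intro e f h1 h2
    exact (hσ e f).1 (h1.trans hS h2 (by omega) (by omega))

lemma main_aux [Finite A] [TopologicalSpace A] [DiscreteTopology A] (hS : Setup X Y Φ)
    (hcl : IsClosed X) (hirr : IrreducibleSubshift X)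
    (d : ℕ) (hd : classDegree X Y (fun x i => Φ (x i)) = d)
    (p : ℕ) (w : Fin (p + 1) → B) (hw : IsMagicBlock X Y Φ w) :
    ∃ Bs : Fin d → Set (Fin (p + 1) → A),
      (∀ u, u ∈ blockPre X Φ w ↔ ∃ j, u ∈ Bs j) ∧
      (∀ j j' : Fin d, j ≠ j' → Disjoint (Bs j) (Bs j')) ∧
      ∀ z : ℤ → B, DoublyTransitive Y z →
        ∀ i : ℤ, (∀ j : Fin (p + 1), z (i + (j.1 : ℤ)) = w j) →
          ∃ ρ : transClassesOver X (fun x i => Φ (x i)) z → Fin d, Function.Bijective ρ ∧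
            ∀ D : transClassesOver X (fun x i => Φ (x i)) z, ∀ x ∈ (D : Set (ℤ → A)),
              (fun j : Fin (p + 1) => x (i + (j.1 : ℤ))) ∈ Bs (ρ D) := by
  classical
  obtain ⟨yw, hyw, -⟩ := hw.1
  -- the minimum is attained
  obtain ⟨yd, hyd, hydc⟩ : d ∈ {d | ∃ y ∈ Y,
      Nat.card (transClassesOver X (fun x i => Φ (x i)) y) = d} := by
    rw [← hd]; exact Nat.sInf_mem ⟨_, yw, hyw, rfl⟩
  have hdle : ∀ y ∈ Y, d ≤ Nat.card (transClassesOver X (fun x i => Φ (x i)) y) := by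
    intro y hy
    rw [← hd]; exact Nat.sInf_le ⟨y, hy, rfl⟩
  by_cases hex : ∃ z, DoublyTransitive Y z ∧ ∃ i : ℤ, ∀ j : Fin (p + 1), z (i + (j.1 : ℤ)) = w j
  swap
  · have hpos : 0 < d := by
      rw [← hydc]
      have := classes_finite (A := A) hS yd
      obtain ⟨x, hx, e⟩ := hS.surj yd hyd
      have : Nonempty (transClassesOver X (fun x i => Φ (x i)) yd) := ⟨⟨_, x, hx, e, rfl⟩⟩
      exact Nat.card_pos
    refine ⟨fun j => if j = ⟨0, hpos⟩ then blockPre X Φ w else ∅, fun u => ?_, ?_, ?_⟩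
    · constructor
      · intro hu
        exact ⟨⟨0, hpos⟩, by simpa using hu⟩
      · rintro ⟨j, hj⟩
        by_cases h : j = ⟨0, hpos⟩
        · simpa [h] using hj
        · simp [h] at hj
    · intro j j' hne
      by_cases h : j = ⟨0, hpos⟩
      · have : j' ≠ ⟨0, hpos⟩ := fun h' => hne (h.trans h'.symm)
        simp [this]
      · simp [h]
    · intro z hz i hi
      exact absurd ⟨z, hz, i, hi⟩ hex
  obtain ⟨z', hz', i', hi'⟩ := hex
  -- minimal transition block
  obtain ⟨v0, hv0, L0, M0, htb0, hM0⟩ := exists_tb hS hcl hyd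
  obtain ⟨y0, hy0, L, M, htb, hMc⟩ := Nat.sInf_mem (s := {c | ∃ y ∈ Y, ∃ (L : ℕ) (M : Set A),
    TBat X Φ y 0 L M ∧ M.ncard = c}) ⟨_, v0, hv0, L0, M0, htb0, rfl⟩
  have hM : MinTB X Y Φ y0 L M := by
    refine ⟨hy0, htb, fun y hy L' M' h => ?_⟩
    rw [hMc]
    exact Nat.sInf_le ⟨y, hy, L', M', h, rfl⟩
  have hMd : M.ncard ≤ d := by
    have := hM.min _ hv0 _ _ htb0
    omega
  have hc : ∀ y ∈ Y, M.ncard ≤ Nat.card (transClassesOver X (fun x i => Φ (x i)) y) :=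
    fun y hy => hMd.trans (hdle y hy)
  have hz'Y := hz'.1.1
  obtain ⟨k, hk⟩ := magic_ext hS hw
  have hk2 := k.2
  obtain ⟨m, hm1, hm⟩ := lt_occ hS hz'.2 hy0 (i' - L) L
  obtain ⟨n, hn1, hn⟩ := rt_occ hS hz'.1 hy0 (i' + p + L) L
  obtain ⟨σ, hσ⟩ := sandwich hS hM hz'.1 (hc _ hz'Y) hirr hk hz'Y hi' hm hn (by omega) (by omega)
  have hcard : Nat.card M = d := by
    obtain ⟨ρ, hρ, -⟩ := class_bij hS hM hz' (hc _ hz'Y) hirr hm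
    have h1 := Nat.card_eq_of_bijective ρ hρ
    have h2 := hdle z' hz'Y
    have h3 : Nat.card M = M.ncard := Nat.card_coe_set_eq M
    omega
  have E : Fin d ≃ M := (finCongr hcard.symm).trans (Finite.equivFin M).symm
  refine ⟨fun j => {u | u ∈ blockPre X Φ w ∧ Pth X Φ z' m (i' + (k.1 : ℤ)) (E j) (u k)},
    fun u => ?_, fun j j' hne => ?_, fun z hz i hi => ?_⟩
  · constructor
    · intro hu
      obtain ⟨⟨e, he⟩, -, -⟩ := hσ u hu
      exact ⟨E.symm e, hu, by simpa using he⟩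
    · rintro ⟨j, hu, -⟩
      exact hu
  · rw [Set.disjoint_left]
    rintro u ⟨hu, h1⟩ ⟨-, h2⟩
    obtain ⟨-, ⟨f, hf⟩, h⟩ := hσ u hu
    exact hne (E.injective (σ.injective ((h _ _ h1 hf).symm.trans (h _ _ h2 hf))))
  · have hzY := hz.1.1
    obtain ⟨n, hn1, hn⟩ := rt_occ hS hz.1 hy0 (i + p + L) L
    -- the glued word
    obtain ⟨x0, hx0, e0⟩ := hS.surj z hzY
    have hu0 : (fun j : Fin (p + 1) => x0 (i + (j.1 : ℤ))) ∈ blockPre X Φ w :=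
      ⟨⟨x0, hx0, i, fun _ => rfl⟩, fun j => (congrFun e0 _).trans (hi j)⟩
    obtain ⟨a, ha, a1, a2⟩ := hk z' hz'Y i' hi' _ hu0 ((i' - m).natAbs + L)
    obtain ⟨b, hb, b1, b2⟩ := hk z hzY i hi _ hu0 ((n - i).natAbs + L)
    have hg := hS.glue a ha _ (hS.shX (i - i') b hb) (i' + (k.1 : ℤ)) (by
      rw [a1, ← b1]; congr 1; ring)
    obtain ⟨v, hvY, v1, v2⟩ : ∃ v ∈ Y, (∀ t, m - L ≤ t → t ≤ i' + (k.1 : ℤ) → v t = z' t) ∧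
        (∀ t, i ≤ t → t ≤ n + L → v (t + (i' - i)) = z t) := by
      refine ⟨_, hS.img _ hg, fun t t1 t2 => ?_, fun t t1 t2 => ?_⟩
      · simp only [if_pos t2]
        exact a2 t (by omega) (by omega)
      · by_cases h : t + (i' - i) ≤ i' + (k.1 : ℤ)
        · simp only [if_pos h]
          rw [a2 _ (by omega) (by omega)]
          have c1 := hi ⟨(t - i).toNat, by omega⟩
          have c2 := hi' ⟨(t - i).toNat, by omega⟩
          rw [← c1] at c2
          simp only [Int.toNat_of_nonneg (show 0 ≤ t - i by omega)] at c2
          rw [show t + (i' - i) = i' + (t - i) by ring, c2]; congr 1; ring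
        · simp only [if_neg h]
          rw [show t + (i' - i) + (i - i') = t by ring]
          exact b2 t (by omega) (by omega)
    have ov : ∀ j : Fin (p + 1), v (i' + (j.1 : ℤ)) = w j := by
      intro j
      have := j.2
      rw [← hi j, ← v2 _ (by omega) (by omega)]; congr 1; ring
    have om : Occ y0 L v m := by
      intro t t1 t2
      rw [v1 _ (by omega) (by omega)]; exact hm t t1 t2
    have on : Occ y0 L v (n + (i' - i)) := by
      intro t t1 t2
      rw [← add_assoc, v2 _ (by omega) (by omega)]; exact hn t t1 t2
    obtain ⟨τ, hτ⟩ := sandwich hS hM hz.1 (hc _ hzY) hirr hk hvY ov om on (by omega) (by omega)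
    obtain ⟨ρ, hρ, hρ2⟩ := class_bij hS hM hz (hc _ hzY) hirr hn
    refine ⟨fun D => E.symm (τ.symm (ρ D)),
      E.symm.bijective.comp (τ.symm.bijective.comp hρ), fun D x hx => ?_⟩
    have hcn := hρ2 D x hx
    obtain ⟨q, hq, hqe, hDq⟩ := class_rep D
    have hx2 := hx
    rw [hDq] at hx2
    have hxX := hx2.1
    have ex : ∀ t, Φ (x t) = z t := fun t => (congrFun hx2.2.1 t).trans (hqe t)
    have hu : (fun j : Fin (p + 1) => x (i + (j.1 : ℤ))) ∈ blockPre X Φ w :=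
      ⟨⟨x, hxX, i, fun _ => rfl⟩, fun j => (ex _).trans (hi j)⟩
    refine ⟨hu, ?_⟩
    obtain ⟨⟨e, he⟩, -, h⟩ := hτ _ hu
    have r1 : Pth X Φ z (i + (k.1 : ℤ)) n (x (i + (k.1 : ℤ))) (ρ D) :=
      (Pth.self hxX fun t _ _ => ex t).trans hS hcn.1 (by omega) (by omega)
    have r2 := r1.shift hS (y' := v) (s' := i' + (k.1 : ℤ)) (t' := n + (i' - i)) (i' - i)
      (by ring) rfl (fun t t1 t2 => v2 t (by omega) (by omega))
    have r3 := h e (ρ D) he r2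
    have r4 : E (E.symm (τ.symm (ρ D))) = e := by simp [r3]
    rw [r4]
    exact he.congr fun t t1 t2 => (v1 t (by omega) t2).symm

end assemble

end MBP
theorem magic_block_partition [Fintype A] [TopologicalSpace A] [DiscreteTopology A]
    [Fintype B] [TopologicalSpace B] [DiscreteTopology B]
    (X : Set (ℤ → A)) (Y : Set (ℤ → B)) (π : (ℤ → A) → ℤ → B) (Φ : A → B)
    (hT : FactorTriple X Y π) (hXirr : IrreducibleSubshift X)
    (hX1 : IsOneStep X) (hΦ : OneBlockRule π Φ)
    (d : ℕ) (hd : classDegree X Y π = d)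
    (p : ℕ) (w : Fin (p + 1) → B) (hw : IsMagicBlock X Y Φ w) :
    ∃ Bs : Fin d → Set (Fin (p + 1) → A),
      (∀ u, u ∈ blockPre X Φ w ↔ ∃ j, u ∈ Bs j) ∧
      (∀ j j' : Fin d, j ≠ j' → Disjoint (Bs j) (Bs j')) ∧
      ∀ z : ℤ → B, DoublyTransitive Y z →
        ∀ i : ℤ, (∀ j : Fin (p + 1), z (i + (j.1 : ℤ)) = w j) →
          ∃ ρ : transClassesOver X π z → Fin d, Function.Bijective ρ ∧
            ∀ D : transClassesOver X π z, ∀ x ∈ (D : Set (ℤ → A)),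
              (fun j : Fin (p + 1) => x (i + (j.1 : ℤ))) ∈ Bs (ρ D) := by
  have hπ : π = fun x i => Φ (x i) := by
    funext x i; exact hΦ x i
  subst hπ
  obtain ⟨-, hYs, -, himg, hsurj⟩ := hT
  obtain ⟨⟨hcl, hsh⟩, T, hXT⟩ := hX1
  refine MBP.main_aux ⟨?_, fun n x hx => hsh n x hx, fun n y hy => hYs.2 n y hy,
    himg, hsurj⟩ hcl hXirr d hd p w hw
  intro x hx x' hx' t ht
  rw [hXT] at hx hx' ⊢
  intro i
  have h1 := hx i
  have h2 := hx' i
  by_cases h : i + 1 ≤ t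
  · simpa [h, show i ≤ t by omega] using h1
  · by_cases h' : i ≤ t
    · have : i = t := by omega
      subst this
      simpa [ht] using h2
    · simpa [h, h'] using h2
end

section
/- Let (X, Y, π) be an irreducible factor triple. If y ∈ Y is doubly transitive and x ∈ π⁻¹(y), then the transition class of x equals the reversed transition class of x. -/
open Set

universe u v uc

variable {A : Type u} {B : Type v}

/-! ### A lemma on finite semigroups of relations -/

section Semigroup

variable {D : Type}

/-- Composition of relations. -/
def rcomp {V₁ V₂ V₃ : Type*} (S : V₁ → V₂ → Prop) (T : V₂ → V₃ → Prop) : V₁ → V₃ → Prop :=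
  fun k l => ∃ j, S k j ∧ T j l

lemma exists_pow_mem (M : Set (D → D → Prop))
    (hcl : ∀ S ∈ M, ∀ T ∈ M, rcomp S T ∈ M) (S : D → D → Prop) (hS : S ∈ M)
    (σ : Equiv.Perm D) (hσ : ∀ k, S k (σ k)) (n : ℕ) :
    ∃ U ∈ M, ∀ k, U k ((σ ^ (n + 1)) k) := by
  induction n with
  | zero => exact ⟨S, hS, by simpa using hσ⟩
  | succ n ih =>
    obtain ⟨U, hU, h⟩ := ih
    refine ⟨rcomp U S, hcl _ hU _ hS, fun k => ⟨_, h k, ?_⟩⟩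
    rw [pow_succ' σ (n + 1)]
    exact hσ _

lemma exists_inv_mem [Finite D] (M : Set (D → D → Prop))
    (hcl : ∀ S ∈ M, ∀ T ∈ M, rcomp S T ∈ M) (S : D → D → Prop) (hS : S ∈ M)
    (σ : Equiv.Perm D) (hσ : ∀ k, S k (σ k)) :
    ∃ U ∈ M, ∀ k, U k (σ⁻¹ k) := by
  have hpos : 0 < orderOf σ := orderOf_pos σ
  obtain ⟨U, hU, h⟩ := exists_pow_mem M hcl S hS σ hσ (2 * orderOf σ - 2)
  refine ⟨U, hU, fun k => ?_⟩
  have : σ ^ (2 * orderOf σ - 2 + 1) = σ⁻¹ := by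
    rw [eq_inv_iff_mul_eq_one, ← pow_succ]
    have : 2 * orderOf σ - 2 + 1 + 1 = orderOf σ * 2 := by omega
    rw [this, pow_mul, pow_orderOf_eq_one, one_pow]
  rw [← this]
  exact h k

lemma semigroup_perm [Finite D] (M : Set (D → D → Prop))
    (hcl : ∀ S ∈ M, ∀ T ∈ M, rcomp S T ∈ M)
    (hperm : ∀ S ∈ M, ∃ σ : Equiv.Perm D, ∀ k, S k (σ k))
    (htr : ∀ k l, ∃ S ∈ M, S k l)
    (heq : ∀ T ∈ M, Equivalence T → ∀ k l, T k l → k = l) :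
    ∀ S ∈ M, ∃ σ : Equiv.Perm D, ∀ k j, S k j → j = σ k := by
  intro S hS
  -- a maximal reflexive element
  have hne : {T | T ∈ M ∧ ∀ k, T k k}.Nonempty := by
    obtain ⟨σ, hσ⟩ := hperm S hS
    obtain ⟨U, hU, h⟩ := exists_inv_mem M hcl S hS σ hσ
    exact ⟨rcomp S U, hcl _ hS _ hU, fun k => ⟨σ k, hσ k, by simpa using h (σ k)⟩⟩
  obtain ⟨T, hT⟩ := (Set.toFinite {T | T ∈ M ∧ ∀ k, T k k}).exists_maximal hne
  have hTM : T ∈ M := hT.prop.1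
  have hTr : ∀ k, T k k := hT.prop.2
  have hgr : ∀ U ∈ M, (∀ k, U k k) → ∀ k l, U k l → T k l := by
    intro U hU hUr k l hkl
    have h1 : rcomp T U ∈ {T | T ∈ M ∧ ∀ k, T k k} :=
      ⟨hcl _ hTM _ hU, fun k => ⟨k, hTr k, hUr k⟩⟩
    have h2 : T ≤ rcomp T U := fun a b hab => ⟨b, hab, hUr b⟩
    exact hT.le_of_ge h1 h2 k l ⟨k, hTr k, hkl⟩
  have htrans : ∀ a b c, T a b → T b c → T a c := fun a b c hab hbc =>
    hgr _ (hcl _ hTM _ hTM) (fun k => ⟨k, hTr k, hTr k⟩) a c ⟨b, hab, hbc⟩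
  have hA : ∀ S ∈ M, ∀ σ : Equiv.Perm D, (∀ k, S k (σ k)) → ∀ k j, S k j → T k (σ⁻¹ j) := by
    intro S hS σ hσ k j hkj
    obtain ⟨U, hU, h⟩ := exists_inv_mem M hcl S hS σ hσ
    exact hgr _ (hcl _ hS _ hU) (fun k => ⟨σ k, hσ k, by simpa using h (σ k)⟩) _ _
      ⟨j, hkj, h j⟩
  have hB : ∀ S ∈ M, ∀ σ : Equiv.Perm D, (∀ k, S k (σ k)) →
      ∀ k j, T k j → T (σ⁻¹ k) (σ⁻¹ j) := by
    intro S hS σ hσ k j hkj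
    obtain ⟨U, hU, h⟩ := exists_inv_mem M hcl S hS σ hσ
    refine hgr _ (hcl _ hS _ (hcl _ hTM _ hU))
      (fun k => ⟨σ k, hσ k, σ k, hTr _, by simpa using h (σ k)⟩) _ _
      ⟨k, ?_, j, hkj, h j⟩
    simpa using hσ (σ⁻¹ k)
  have hsymm : ∀ a b, T a b → T b a := by
    intro a b hab
    obtain ⟨S, hS, hba⟩ := htr b a
    obtain ⟨σ, hσ⟩ := hperm S hS
    have h1 : {c | T b c} ⊆ {c | T a c} := fun c hc => htrans _ _ _ hab hc
    have h2 : {c | T (σ⁻¹ a) c} ⊆ {c | T b c} :=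
      fun c hc => htrans _ _ _ (hA S hS σ hσ _ _ hba) hc
    have h3 : {c | T a c}.ncard ≤ {c | T (σ⁻¹ a) c}.ncard :=
      Set.ncard_le_ncard_of_injOn (fun c => σ⁻¹ c) (fun c hc => hB S hS σ hσ _ _ hc)
        (fun _ _ _ _ h => (σ⁻¹).injective h) (Set.toFinite _)
    have h4 := Set.ncard_le_ncard h2 (Set.toFinite _)
    have h5 := Set.eq_of_subset_of_ncard_le h1 (h3.trans h4) (Set.toFinite _)
    have : a ∈ {c | T a c} := hTr a
    rw [← h5] at this
    exact this
  have hid := heq T hTM ⟨hTr, fun h => hsymm _ _ h, fun h h' => htrans _ _ _ h h'⟩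
  obtain ⟨σ, hσ⟩ := hperm S hS
  refine ⟨σ, fun k j hkj => ?_⟩
  have := hid _ _ (hA S hS σ hσ _ _ hkj)
  rw [this]; simp

end Semigroup

/-! ### Labelled graphs -/

section Graph

variable {V : Type*} {C : Type*} (E : V → V → Prop) (Ψ : V → C)

/-- Existence of a path over the word `w`. -/
def RW : List C → V → V → Prop
  | [], s, t => s = t
  | b :: w, s, t => Ψ s = b ∧ ∃ u, E s u ∧ RW w u t

lemma RW_append (v w : List C) (s t : V) :
    RW E Ψ (v ++ w) s t ↔ ∃ u, RW E Ψ v s u ∧ RW E Ψ w u t := by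
  induction v generalizing s with
  | nil => simp [RW]
  | cons b v ih =>
    simp only [List.cons_append, RW, ih]
    constructor
    · rintro ⟨h, u, hu, u', h1, h2⟩; exact ⟨u', ⟨h, u, hu, h1⟩, h2⟩
    · rintro ⟨u', ⟨h, u, hu, h1⟩, h2⟩; exact ⟨h, u, hu, u', h1, h2⟩

/-- The relation `R` factors through the set `D`. -/
def FacBy (D : Type) (R : V → V → Prop) : Prop :=
  ∃ (P : V → D → Prop) (Q : D → V → Prop), ∀ s t, R s t ↔ ∃ k, P s k ∧ Q k t

lemma FacBy.equiv {D D' : Type} (e : D ≃ D') {R : V → V → Prop} (h : FacBy D R) :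
    FacBy D' R := by
  obtain ⟨P, Q, h⟩ := h
  refine ⟨fun s k => P s (e.symm k), fun k t => Q (e.symm k) t, fun s t => ?_⟩
  rw [h]
  exact ⟨fun ⟨k, hk⟩ => ⟨e k, by simpa using hk⟩, fun ⟨k, hk⟩ => ⟨e.symm k, hk⟩⟩

theorem exists_magic [Finite V] [Nonempty V] (conn : ∀ s t, ∃ v, RW E Ψ v s t) :
    ∃ (w : List C) (D : Type) (P : V → D → Prop) (Q : D → V → Prop),
      (∃ s t, RW E Ψ w s t) ∧ (∀ s t, RW E Ψ w s t ↔ ∃ k, P s k ∧ Q k t) ∧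
      ∀ v, ∃ σ : Equiv.Perm D, ∀ k l s t, Q k s → RW E Ψ v s t → P t l → l = σ k := by
  classical
  have hex : ∃ d : ℕ, ∃ w : List C, (∃ s t, RW E Ψ w s t) ∧ FacBy (Fin d) (RW E Ψ w) := by
    obtain ⟨n, ⟨e⟩⟩ := Finite.exists_equiv_fin V
    refine ⟨n, [], ⟨Classical.arbitrary V, _, rfl⟩, fun s k => e s = k, fun k t => e t = k, ?_⟩
    intro s t
    simp [RW, eq_comm]
  obtain ⟨w, hw, hfac⟩ := Nat.find_spec hex
  have hmin : ∀ (ι : Type) [Finite ι] (v : List C), (∃ s t, RW E Ψ v s t) →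
      FacBy ι (RW E Ψ v) → Nat.find hex ≤ Nat.card ι := by
    intro ι _ v hv hf
    exact Nat.find_min' hex ⟨v, hv, hf.equiv (Finite.equivFin ι)⟩
  generalize Nat.find hex = d at hfac hmin
  obtain ⟨P, Q, hPQ⟩ := hfac
  -- the columns of `P` and the rows of `Q` are nonzero
  have hsub : ∀ p : Fin d → Prop, (∀ s k t, P s k → Q k t → p k) → ∀ k, p k := by
    intro p hp k
    by_contra hk
    have h1 : FacBy {k // p k} (RW E Ψ w) := by
      refine ⟨fun s k => P s k, fun k t => Q k t, fun s t => ?_⟩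
      rw [hPQ]
      exact ⟨fun ⟨k, h, h'⟩ => ⟨⟨k, hp _ _ _ h h'⟩, h, h'⟩, fun ⟨k, h⟩ => ⟨k, h⟩⟩
    have h2 := hmin _ w hw h1
    rw [Nat.card_eq_fintype_card] at h2
    have h3 := Fintype.card_subtype_lt (p := p) hk
    simp only [Fintype.card_fin] at h3
    omega
  have hP : ∀ k, ∃ s, P s k := hsub _ fun s k t h _ => ⟨s, h⟩
  have hQ : ∀ k, ∃ t, Q k t := hsub _ fun s k t _ h => ⟨t, h⟩
  let T : List C → Fin d → Fin d → Prop := fun v k l => ∃ s t, Q k s ∧ RW E Ψ v s t ∧ P t l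
  have hPTQ : ∀ v s t, RW E Ψ (w ++ v ++ w) s t ↔ ∃ k l, P s k ∧ T v k l ∧ Q l t := by
    intro v s t
    simp only [RW_append, hPQ, T]
    constructor
    · rintro ⟨b, ⟨a, ⟨k, h1, h2⟩, h3⟩, l, h4, h5⟩
      exact ⟨k, l, h1, ⟨a, b, h2, h3, h4⟩, h5⟩
    · rintro ⟨k, l, h1, ⟨a, b, h2, h3, h4⟩, h5⟩
      exact ⟨b, ⟨a, ⟨k, h1, h2⟩, h3⟩, l, h4, h5⟩
  have hTmul : ∀ v v', rcomp (T v) (T v') = T (v ++ w ++ v') := by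
    intro v v'
    ext k l
    simp only [rcomp, T, RW_append, hPQ]
    constructor
    · rintro ⟨j, ⟨a, b, h1, h2, h3⟩, c, e, h4, h5, h6⟩
      exact ⟨a, e, h1, ⟨c, ⟨b, h2, j, h3, h4⟩, h5⟩, h6⟩
    · rintro ⟨a, e, h1, ⟨c, ⟨b, h2, j, h3, h4⟩, h5⟩, h6⟩
      exact ⟨j, ⟨a, b, h1, h2, h3⟩, c, e, h4, h5, h6⟩
  have hnz : ∀ v k l, T v k l → ∃ s t, RW E Ψ (w ++ v ++ w) s t := by
    intro v k l h
    obtain ⟨s, hs⟩ := hP k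
    obtain ⟨t, ht⟩ := hQ l
    exact ⟨s, t, (hPTQ v s t).2 ⟨k, l, hs, h, ht⟩⟩
  have hpos : ∃ k : Fin d, True := by
    obtain ⟨s, t, h⟩ := hw
    obtain ⟨k, -⟩ := (hPQ s t).1 h
    exact ⟨k, trivial⟩
  obtain ⟨k₀, -⟩ := hpos
  have hhall : ∀ v, (∃ k l, T v k l) → ∃ σ : Equiv.Perm (Fin d), ∀ k, T v k (σ k) := by
    rintro v ⟨k1, l1, h1⟩
    have hall := (Fintype.all_card_le_filter_rel_iff_exists_injective (T v)).1 ?_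
    · obtain ⟨f, hf, hf'⟩ := hall
      exact ⟨Equiv.ofBijective f (Finite.injective_iff_bijective.1 hf), hf'⟩
    · intro S
      have hf : FacBy ({k // k ∉ S} ⊕ {l // ∃ a ∈ S, T v a l}) (RW E Ψ (w ++ v ++ w)) := by
        refine ⟨fun s c => Sum.elim (fun k => P s k.1) (fun l => ∃ k, P s k ∧ T v k l.1) c,
          fun c t => Sum.elim (fun k => ∃ l, T v k.1 l ∧ Q l t) (fun l => Q l.1 t) c, ?_⟩
        intro s t
        rw [hPTQ]
        constructor
        · rintro ⟨k, l, h1, h2, h3⟩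
          by_cases hk : k ∈ S
          · exact ⟨Sum.inr ⟨l, k, hk, h2⟩, ⟨k, h1, h2⟩, h3⟩
          · exact ⟨Sum.inl ⟨k, hk⟩, h1, ⟨l, h2, h3⟩⟩
        · rintro ⟨k | l, h1, h2⟩
          · obtain ⟨l, h2, h3⟩ := h2
            exact ⟨k, l, h1, h2, h3⟩
          · obtain ⟨k, h1, h3⟩ := h1
            exact ⟨k, l, h1, h3, h2⟩
      have h2 := hmin _ _ (hnz _ _ _ h1) hf
      rw [Nat.card_eq_fintype_card, Fintype.card_sum, Fintype.card_subtype,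
        Fintype.card_subtype] at h2
      have h3 : (Finset.univ.filter fun k => k ∉ S).card = d - S.card := by
        have : (Finset.univ.filter fun k => k ∉ S) = Sᶜ := by ext; simp
        rw [this, Finset.card_compl, Fintype.card_fin]
      have h4 : S.card ≤ d := by simpa using S.card_le_univ
      rw [h3] at h2
      have h5 : S.card ≤ (Finset.univ.filter fun l => ∃ a ∈ S, T v a l).card := by omega
      convert h5
  -- the semigroup
  have hsg := semigroup_perm {S | ∃ v, S = T v ∧ ∃ k l, T v k l} ?_ ?_ ?_ ?_
  · refine ⟨w, Fin d, P, Q, hw, hPQ, fun v => ?_⟩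
    by_cases hv : ∃ k l, T v k l
    · obtain ⟨σ, hσ⟩ := hsg (T v) ⟨v, rfl, hv⟩
      exact ⟨σ, fun k l s t h1 h2 h3 => hσ k l ⟨s, t, h1, h2, h3⟩⟩
    · exact ⟨1, fun k l s t h1 h2 h3 => absurd ⟨k, l, s, t, h1, h2, h3⟩ hv⟩
  · rintro _ ⟨v, rfl, hv⟩ _ ⟨v', rfl, hv'⟩
    refine ⟨v ++ w ++ v', hTmul _ _, ?_⟩
    obtain ⟨σ, hσ⟩ := hhall v hv
    obtain ⟨τ, hτ⟩ := hhall v' hv'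
    refine ⟨k₀, τ (σ k₀), ?_⟩
    rw [← hTmul]
    exact ⟨_, hσ _, hτ _⟩
  · rintro _ ⟨v, rfl, hv⟩
    exact hhall v hv
  · intro k l
    obtain ⟨s, hs⟩ := hQ k
    obtain ⟨t, ht⟩ := hP l
    obtain ⟨v, hv⟩ := conn s t
    have : T v k l := ⟨s, t, hs, hv, ht⟩
    exact ⟨T v, ⟨v, rfl, k, l, this⟩, this⟩
  · rintro _ ⟨v, rfl, k1, l1, h1⟩ heq a b hab
    by_contra hne
    let st : Setoid (Fin d) := ⟨T v, heq⟩
    have hf : FacBy (Quotient st) (RW E Ψ (w ++ v ++ w)) := by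
      refine ⟨fun s c => ∃ k, P s k ∧ Quotient.mk st k = c,
        fun c t => ∃ l, Quotient.mk st l = c ∧ Q l t, fun s t => ?_⟩
      rw [hPTQ]
      constructor
      · rintro ⟨k, l, h1, h2, h3⟩
        exact ⟨_, ⟨k, h1, rfl⟩, l, (Quotient.sound h2).symm, h3⟩
      · rintro ⟨c, ⟨k, h1, rfl⟩, l, h2, h3⟩
        exact ⟨k, l, h1, Quotient.exact h2.symm, h3⟩
    have h2 := hmin _ _ (hnz _ _ _ h1) hf
    have h3 : Fintype.card (Quotient st) < Fintype.card (Fin d) :=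
      Fintype.card_lt_of_surjective_not_injective (Quotient.mk st) Quotient.mk_surjective
        fun hinj => hne (hinj (Quotient.sound hab))
    rw [Nat.card_eq_fintype_card] at h2
    simp only [Fintype.card_fin] at h3
    omega

/-- The block of `y` of length `n` starting at `i`. -/
def Wd (y : ℤ → C) : ℤ → ℕ → List C
  | _, 0 => []
  | i, n + 1 => y i :: Wd y (i + 1) n

lemma Wd_length (y : ℤ → C) (i : ℤ) (n : ℕ) : (Wd y i n).length = n := by
  induction n generalizing i with
  | zero => rfl
  | succ n ih => simp [Wd, ih]

lemma Wd_add (y : ℤ → C) (i : ℤ) (a b : ℕ) :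
    Wd y i (a + b) = Wd y i a ++ Wd y (i + a) b := by
  induction a generalizing i with
  | zero => simp [Wd]
  | succ a ih =>
    rw [show a + 1 + b = (a + b) + 1 by omega]
    simp only [Wd, ih, List.cons_append]
    rw [show i + 1 + (a : ℤ) = i + ((a + 1 : ℕ) : ℤ) by push_cast; ring]

lemma Wd_eq_iff (y y' : ℤ → C) (i i' : ℤ) (n : ℕ) :
    Wd y i n = Wd y' i' n ↔ ∀ m : ℕ, m < n → y (i + m) = y' (i' + m) := by
  induction n generalizing i i' with
  | zero => simp [Wd]
  | succ n ih =>
    simp only [Wd, List.cons.injEq, ih]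
    constructor
    · rintro ⟨h0, h⟩ m hm
      cases m with
      | zero => simpa using h0
      | succ m =>
        have := h m (by omega)
        push_cast
        rw [show i + ((m : ℤ) + 1) = i + 1 + m by ring,
          show i' + ((m : ℤ) + 1) = i' + 1 + m by ring]
        exact this
    · intro h
      refine ⟨by simpa using h 0 (by omega), fun m hm => ?_⟩
      have := h (m + 1) (by omega)
      push_cast at this
      rw [show i + ((m : ℤ) + 1) = i + 1 + m by ring,
          show i' + ((m : ℤ) + 1) = i' + 1 + m by ring] at this
      exact this

variable {E Ψ}

lemma RW_path {p : ℤ → V} {y : ℤ → C} (hp : ∀ m, E (p m) (p (m + 1)))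
    (hy : ∀ m, Ψ (p m) = y m) (i : ℤ) (n : ℕ) : RW E Ψ (Wd y i n) (p i) (p (i + n)) := by
  induction n generalizing i with
  | zero => simp [Wd, RW]
  | succ n ih =>
    refine ⟨hy i, p (i + 1), hp i, ?_⟩
    have := ih (i + 1)
    rwa [show i + 1 + (n : ℤ) = i + ((n + 1 : ℕ) : ℤ) by push_cast; ring] at this

lemma RW_interp (w : List C) (s t : V) (h : RW E Ψ w s t) (i : ℤ) :
    ∃ u : ℤ → V, u i = s ∧ u (i + w.length) = t ∧
      (∀ m, i ≤ m → m < i + w.length → E (u m) (u (m + 1))) ∧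
      Wd (fun m => Ψ (u m)) i w.length = w := by
  induction w generalizing s i with
  | nil =>
    refine ⟨fun _ => s, rfl, h, fun m h1 h2 => ?_, rfl⟩
    simp at h2; omega
  | cons b w ih =>
    obtain ⟨hb, s', hs', h'⟩ := h
    obtain ⟨u, h1, h2, h3, h4⟩ := ih s' h' (i + 1)
    refine ⟨fun m => if m = i then s else u m, by simp, ?_, ?_, ?_⟩
    · dsimp only
      rw [if_neg (by simp; omega), ← h2]
      congr 1; simp only [List.length_cons]; push_cast; ring
    · intro m hm hm'
      simp only [List.length_cons] at hm'
      push_cast at hm'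
      by_cases hmi : m = i
      · subst hmi
        simpa [h1] using hs'
      · simp only [if_neg hmi, if_neg (show m + 1 ≠ i by omega)]
        exact h3 m (by omega) (by omega)
    · simp only [List.length_cons, Wd]
      have h5 : Wd (fun m => Ψ (if m = i then s else u m)) (i + 1) w.length = w := by
        conv_rhs => rw [← h4]
        rw [Wd_eq_iff]
        intro m hm
        rw [if_neg (by omega)]
      rw [h5]
      simpa using hb

lemma RW_glue {p q : ℤ → V} (hp : ∀ m, E (p m) (p (m + 1))) (hq : ∀ m, E (q m) (q (m + 1)))
    (w : List C) (i : ℤ) (h : RW E Ψ w (p i) (q (i + w.length))) :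
    ∃ U : ℤ → V, (∀ m, E (U m) (U (m + 1))) ∧ (∀ m ≤ i, U m = p m) ∧
      (∀ m, i + w.length ≤ m → U m = q m) ∧ Wd (fun m => Ψ (U m)) i w.length = w := by
  obtain ⟨u, h1, h2, h3, h4⟩ := RW_interp w _ _ h i
  have hU1 : ∀ m ≤ i, (fun m => if m < i then p m else if m < i + w.length then u m else q m) m
      = p m := by
    intro m hm
    dsimp only
    split_ifs with a b
    · rfl
    · rw [show m = i by omega, h1]
    · have : m = i := by omega
      subst this
      have hl : m + (w.length : ℤ) = m := by omega
      rw [hl] at h2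
      rw [← h2, h1]
  have hU2 : ∀ m, i ≤ m → m ≤ i + w.length →
      (fun m => if m < i then p m else if m < i + w.length then u m else q m) m = u m := by
    intro m hm hm'
    dsimp only
    split_ifs with a b
    · omega
    · rfl
    · rw [show m = i + w.length by omega, h2]
  refine ⟨fun m => if m < i then p m else if m < i + w.length then u m else q m, ?_, hU1, ?_, ?_⟩
  · intro m
    by_cases a : m < i
    · rw [hU1 m (by omega), hU1 (m + 1) (by omega)]
      exact hp m
    · by_cases b : m < i + w.length
      · rw [hU2 m (by omega) (by omega), hU2 (m + 1) (by omega) (by omega)]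
        exact h3 m (by omega) b
      · dsimp only
        rw [if_neg a, if_neg b, if_neg (by omega), if_neg (by omega)]
        exact hq m
  · intro m hm
    dsimp only
    rw [if_neg (by omega), if_neg (by omega)]
  · conv_rhs => rw [← h4]
    rw [Wd_eq_iff]
    intro m hm
    dsimp only
    rw [if_neg (by omega), if_pos (by omega)]

/-- One crossing gives crossings in both directions arbitrarily far away on both sides. -/
theorem crossings (w : List C) {D : Type} (P : V → D → Prop) (Q : D → V → Prop)
    (hPQ : ∀ s t, RW E Ψ w s t ↔ ∃ k, P s k ∧ Q k t)
    (hσ : ∀ v, ∃ σ : Equiv.Perm D, ∀ k l s t, Q k s → RW E Ψ v s t → P t l → l = σ k)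
    (y : ℤ → C) (hr : ∀ N : ℤ, ∃ i, N ≤ i ∧ Wd y i w.length = w)
    (hl : ∀ N : ℤ, ∃ i, i + w.length ≤ N ∧ Wd y i w.length = w)
    {p q : ℤ → V} (hp : ∀ m, E (p m) (p (m + 1))) (hq : ∀ m, E (q m) (q (m + 1)))
    (hpy : ∀ m, Ψ (p m) = y m) (hqy : ∀ m, Ψ (q m) = y m)
    (a : ℤ) (n : ℕ) (hcr : RW E Ψ (Wd y a n) (p a) (q (a + n))) (N : ℤ) :
    (∃ i, N ≤ i ∧ Wd y i w.length = w ∧ RW E Ψ w (p i) (q (i + w.length)) ∧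
      RW E Ψ w (q i) (p (i + w.length))) ∧
    (∃ i, i + w.length ≤ N ∧ Wd y i w.length = w ∧ RW E Ψ w (p i) (q (i + w.length)) ∧
      RW E Ψ w (q i) (p (i + w.length))) := by
  have lab : ∀ {p : ℤ → V}, (∀ m, E (p m) (p (m + 1))) → (∀ m, Ψ (p m) = y m) →
      ∀ i, Wd y i w.length = w → ∃ k, P (p i) k ∧ Q k (p (i + w.length)) := by
    intro p hp hpy i hi
    rw [← hPQ]
    have := RW_path hp hpy i w.length
    rwa [hi] at this
  obtain ⟨i, hi, hiw⟩ := hl (min a N)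
  obtain ⟨j, hj, hjw⟩ := hr (max (a + n) N)
  obtain ⟨c, hc⟩ : ∃ c : ℕ, i + w.length + c = a := ⟨(a - i - w.length).toNat, by omega⟩
  obtain ⟨e, he⟩ : ∃ e : ℕ, a + n + e = j := ⟨(j - (a + n)).toNat, by omega⟩
  obtain ⟨k, hk1, hk2⟩ := lab hp hpy i hiw
  obtain ⟨k', hk1', hk2'⟩ := lab hq hqy i hiw
  obtain ⟨l, hl1, hl2⟩ := lab hp hpy j hjw
  obtain ⟨l', hl1', hl2'⟩ := lab hq hqy j hjw
  obtain ⟨σ, hσ⟩ := hσ (Wd y (i + w.length) (c + n + e))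
  have hjj : i + w.length + ((c + n + e : ℕ) : ℤ) = j := by push_cast; omega
  have e1 : l = σ k := by
    refine hσ k l _ _ hk2 ?_ hl1
    rw [← hjj]; exact RW_path hp hpy _ _
  have e2 : l' = σ k' := by
    refine hσ k' l' _ _ hk2' ?_ hl1'
    rw [← hjj]; exact RW_path hq hqy _ _
  have e3 : l' = σ k := by
    refine hσ k l' _ _ hk2 ?_ hl1'
    rw [Wd_add, Wd_add, RW_append]
    refine ⟨q (a + n), ?_, ?_⟩
    · rw [RW_append]
      refine ⟨p a, ?_, ?_⟩
      · have := RW_path hp hpy (i + w.length) c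
        rwa [hc] at this
      · rwa [hc]
    · have h1 : i + (w.length : ℤ) + ((c + n : ℕ) : ℤ) = a + n := by push_cast; omega
      rw [h1, ← he]
      exact RW_path hq hqy _ _
  have ek : k' = k := σ.injective (e2.symm.trans e3)
  have el : l' = l := e3.trans e1.symm
  subst ek el
  exact ⟨⟨j, by omega, hjw, (hPQ _ _).2 ⟨_, hl1, hl2'⟩, (hPQ _ _).2 ⟨_, hl1', hl2⟩⟩,
    ⟨i, by omega, hiw, (hPQ _ _).2 ⟨_, hk1, hk2'⟩, (hPQ _ _).2 ⟨_, hk1', hk2⟩⟩⟩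

end Graph

/-! ### The graph of an SFT -/

section Concrete

variable {X : Set (ℤ → A)} {N : ℕ}

/-- The state of the point `x` at time `i`. -/
def stateAt (N : ℕ) (x : ℤ → A) (hx : x ∈ X) (i : ℤ) :
    {s : Fin N → A // OccursIn s X} :=
  ⟨fun j => x (i + (j.1 : ℤ)), x, hx, i, fun _ => rfl⟩

/-- Two states overlap progressively. -/
def overlapE (X : Set (ℤ → A)) (N : ℕ) (s t : {s : Fin N → A // OccursIn s X}) : Prop :=
  ∀ j : ℕ, ∀ h : j + 1 < N, s.1 ⟨j + 1, h⟩ = t.1 ⟨j, by omega⟩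

lemma overlapE_stateAt (x : ℤ → A) (hx : x ∈ X) (i : ℤ) :
    overlapE X N (stateAt N x hx i) (stateAt N x hx (i + 1)) := by
  intro j h
  simp only [stateAt]
  congr 1
  push_cast; ring

lemma point_of_path {k : ℕ} {R : (Fin k → A) → Prop}
    (hX : X = {x | ∀ i : ℤ, R fun j => x (i + (j.1 : ℤ))}) (hk : k ≤ N) (hN : 0 < N)
    (U : ℤ → {s : Fin N → A // OccursIn s X}) (hU : ∀ m, overlapE X N (U m) (U (m + 1))) :
    ∃ (z : ℤ → A) (hz : z ∈ X), (∀ m, stateAt N z hz m = U m) ∧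
      ∀ m, z m = (U m).1 ⟨0, hN⟩ := by
  have key : ∀ (j : ℕ) (hj : j < N) (m : ℤ), (U (m + j)).1 ⟨0, hN⟩ = (U m).1 ⟨j, hj⟩ := by
    intro j
    induction j with
    | zero => intro hj m; simp
    | succ j ih =>
      intro hj m
      rw [hU m j hj, ← ih (by omega) (m + 1)]
      rw [show m + 1 + (j : ℤ) = m + ((j + 1 : ℕ) : ℤ) by push_cast; ring]
  have hz : (fun m => (U m).1 ⟨0, hN⟩) ∈ X := by
    refine (Set.ext_iff.1 hX _).2 fun i => ?_
    obtain ⟨x, hx, i', h⟩ := (U i).2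
    have := (Set.ext_iff.1 hX _).1 hx i'
    convert this using 2 with j
    have hj : j.1 < N := lt_of_lt_of_le j.2 hk
    rw [key j.1 hj i, ← h ⟨j.1, hj⟩]
  refine ⟨_, hz, fun m => ?_, fun m => rfl⟩
  ext j
  exact key j.1 j.2 m

lemma exists_RW_irr [TopologicalSpace A] (hirr : IrreducibleSubshift X) {C : Type*}
    (Ψ : {s : Fin N → A // OccursIn s X} → C) (s t : {s : Fin N → A // OccursIn s X}) :
    ∃ v, RW (overlapE X N) Ψ v s t := by
  obtain ⟨x, hx, i, k, hik, h1, h2⟩ := hirr N N s.1 t.1 s.2 t.2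
  have e1 : stateAt N x hx i = s := by ext j; exact h1 j
  have e2 : stateAt N x hx k = t := by ext j; exact h2 j
  obtain ⟨n, hn⟩ : ∃ n : ℕ, i + n = k := ⟨(k - i).toNat, by omega⟩
  have := RW_path (E := overlapE X N) (Ψ := Ψ) (p := stateAt N x hx)
    (y := fun m => Ψ (stateAt N x hx m)) (overlapE_stateAt x hx) (fun _ => rfl) i n
  rw [e1, hn, e2] at this
  exact ⟨_, this⟩

theorem all_transitions [Finite A] [TopologicalSpace A] [TopologicalSpace B]
    (X : Set (ℤ → A)) (Y : Set (ℤ → B)) (π : (ℤ → A) → ℤ → B)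
    (hT : FactorTriple X Y π) (hXirr : IrreducibleSubshift X)
    (y : ℤ → B) (hy : DoublyTransitive Y y)
    (x : ℤ → A) (hx : x ∈ X) (hpx : π x = y) (x' : ℤ → A) (hx' : x' ∈ X) (hpx' : π x' = y)
    (z : ℤ → A) (hz : z ∈ X) (hpz : π z = y) (a₀ b₀ : ℤ)
    (hza : ∀ m ≤ a₀, z m = x m) (hzb : ∀ m, b₀ ≤ m → z m = x' m) :
    TransEquiv X π x x' ∧ RevTransEquiv X π x x' := by
  obtain ⟨⟨-, k, R, hX⟩, ⟨-, hYs⟩, ⟨r, Φ, hΦ⟩, hXY, -⟩ := hT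
  obtain ⟨N, hN⟩ : ∃ N : ℕ, N = k + (2 * r + 1) := ⟨_, rfl⟩
  have hN0 : 0 < N := by omega
  let Ψ : {s : Fin N → A // OccursIn s X} → B :=
    fun s => Φ fun j : Fin (2 * r + 1) => s.1 ⟨j.1, by have := j.2; omega⟩
  have hΨ : ∀ (x : ℤ → A) (hx : x ∈ X) (m : ℤ), Ψ (stateAt N x hx m) = π x (m + r) := by
    intro x hx m
    rw [hΦ]
    simp only [Ψ, stateAt, add_sub_cancel_right]
  have : Nonempty {s : Fin N → A // OccursIn s X} := ⟨stateAt N x hx 0⟩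
  obtain ⟨w, D, P, Q, ⟨s, t, hst⟩, hPQ, hσ⟩ :=
    exists_magic (overlapE X N) Ψ (exists_RW_irr hXirr Ψ)
  -- a point of `X` whose image contains `w`
  obtain ⟨v, hv, hvw⟩ : ∃ v ∈ X, Wd (fun m => π v (m + r)) 0 w.length = w := by
    obtain ⟨x0, hx0, i0, h0⟩ := s.2
    obtain ⟨x1, hx1, i1, h1⟩ := t.2
    obtain ⟨U, hU, -, -, hUw⟩ := RW_glue (E := overlapE X N) (Ψ := Ψ)
      (p := fun m => stateAt N x0 hx0 (m + i0))
      (q := fun m => stateAt N x1 hx1 (m - w.length + i1))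
      (fun m => by
        have := overlapE_stateAt (N := N) x0 hx0 (m + i0)
        rwa [show m + i0 + 1 = m + 1 + i0 by ring] at this)
      (fun m => by
        have := overlapE_stateAt (N := N) x1 hx1 (m - w.length + i1)
        rwa [show m - w.length + i1 + 1 = m + 1 - w.length + i1 by ring] at this)
      w 0 (by
        have e1 : stateAt N x0 hx0 (0 + i0) = s := by
          ext j; simpa [stateAt] using h0 j
        have e2 : stateAt N x1 hx1 (0 + w.length - w.length + i1) = t := by
          ext j; simpa [stateAt] using h1 j
        rw [e1, e2]; exact hst)
    obtain ⟨v, hv, hvU, -⟩ := point_of_path hX (by omega) hN0 U hU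
    refine ⟨v, hv, ?_⟩
    simp only [← hvU, hΨ] at hUw
    exact hUw
  have hvw' : ∀ i, (∀ m : ℕ, m < w.length → y (i + m + r) = π v (m + r)) →
      Wd (fun m => y (m + r)) i w.length = w := by
    intro i h
    conv_rhs => rw [← hvw]
    rw [Wd_eq_iff]
    intro m hm
    simpa using h m hm
  have hr : ∀ M : ℤ, ∃ i, M ≤ i ∧ Wd (fun m => y (m + r)) i w.length = w := by
    intro M
    obtain ⟨n, hn, h⟩ := hy.1.2 (shiftMap (-(M.toNat : ℤ)) (π v)) (hYs _ _ (hXY v hv))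
      (M.toNat + w.length + r)
    refine ⟨n + M.toNat, by omega, hvw' _ fun m hm => ?_⟩
    have := h (m + r + M.toNat) (by rw [abs_le]; push_cast; constructor <;> omega)
    rw [shiftMap] at this
    convert this using 2 <;> ring
  have hl : ∀ M : ℤ, ∃ i, i + w.length ≤ M ∧ Wd (fun m => y (m + r)) i w.length = w := by
    intro M
    obtain ⟨n, hn, h⟩ := hy.2.2 (shiftMap (((-M).toNat + w.length : ℕ) : ℤ) (π v))
      (hYs _ _ (hXY v hv)) ((-M).toNat + w.length + r)
    refine ⟨n - ((-M).toNat + w.length : ℕ), by push_cast; omega, hvw' _ fun m hm => ?_⟩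
    have := h (m + r - ((-M).toNat + w.length : ℕ))
      (by rw [abs_le]; push_cast; constructor <;> omega)
    rw [shiftMap] at this
    convert this using 2 <;> ring
  have hlabel : ∀ (x : ℤ → A) (hx : x ∈ X), π x = y →
      ∀ m, Ψ (stateAt N x hx m) = (fun m => y (m + r)) m := by
    intro x hx hp m
    rw [hΨ, hp]
  -- the initial crossing
  obtain ⟨a, ha1, ha2⟩ : ∃ a : ℤ, a + N ≤ a₀ ∧ a ≤ b₀ := ⟨min (a₀ - N) b₀, by omega, by omega⟩
  obtain ⟨n, hn⟩ : ∃ n : ℕ, a + n = b₀ := ⟨(b₀ - a).toNat, by omega⟩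
  have hcr : RW (overlapE X N) Ψ (Wd (fun m => y (m + r)) a n) (stateAt N x hx a)
      (stateAt N x' hx' (a + n)) := by
    have h1 : stateAt N x hx a = stateAt N z hz a := by
      ext j; have := j.2; exact (hza _ (by omega)).symm
    have h2 : stateAt N x' hx' (a + n) = stateAt N z hz (a + n) := by
      ext j; exact (hzb _ (by omega)).symm
    rw [h1, h2]
    exact RW_path (p := stateAt N z hz) (overlapE_stateAt z hz) (hlabel z hz hpz) a n
  have hcross := crossings w P Q hPQ hσ (fun m => y (m + r)) hr hl
    (p := stateAt N x hx) (q := stateAt N x' hx') (overlapE_stateAt x hx)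
    (overlapE_stateAt x' hx') (hlabel x hx hpx) (hlabel x' hx' hpx') a n hcr
  have build : ∀ (x : ℤ → A) (hx : x ∈ X) (x' : ℤ → A) (hx' : x' ∈ X), π x = y → π x' = y →
      ∀ i, Wd (fun m => y (m + r)) i w.length = w →
      RW (overlapE X N) Ψ w (stateAt N x hx i) (stateAt N x' hx' (i + w.length)) →
      ∃ z ∈ X, π z = y ∧ (∀ m ≤ i, z m = x m) ∧ ∀ m, i + w.length ≤ m → z m = x' m := by
    intro x hx x' hx' hp hp' i hi h
    obtain ⟨U, hU, hU1, hU2, hUw⟩ := RW_glue (p := stateAt N x hx) (q := stateAt N x' hx')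
      (overlapE_stateAt x hx) (overlapE_stateAt x' hx') w i h
    obtain ⟨z, hz, hzU, hz0⟩ := point_of_path hX (by omega) hN0 U hU
    refine ⟨z, hz, ?_, ?_, ?_⟩
    · funext m
      have h1 : ∀ m, Ψ (U m) = y (m + r) := by
        intro m
        by_cases c1 : m ≤ i
        · rw [hU1 m c1]; exact hlabel x hx hp m
        · by_cases c2 : i + w.length ≤ m
          · rw [hU2 m c2]; exact hlabel x' hx' hp' m
          · have h2 := (Wd_eq_iff _ _ _ _ _).1 (hUw.trans hi.symm) (m - i).toNat (by omega)
            rw [show i + (((m - i).toNat : ℕ) : ℤ) = m by omega] at h2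
            exact h2
      have h3 := h1 (m - r)
      rw [← hzU, hΨ] at h3
      simpa using h3
    · intro m hm
      rw [hz0, hU1 m hm]; simp [stateAt]
    · intro m hm
      rw [hz0, hU2 m hm]; simp [stateAt]
  refine ⟨⟨fun M => ?_, fun M => ?_⟩, ⟨fun M => ?_, fun M => ?_⟩⟩
  · obtain ⟨i, hi, hiw, h, -⟩ := (hcross M).1
    obtain ⟨z, hz, h1, h2, h3⟩ := build x hx x' hx' hpx hpx' i hiw h
    exact ⟨z, hz, h1.trans hpx.symm, fun m hm => h2 m (by omega), i + w.length, by omega, h3⟩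
  · obtain ⟨i, hi, hiw, -, h⟩ := (hcross M).1
    obtain ⟨z, hz, h1, h2, h3⟩ := build x' hx' x hx hpx' hpx i hiw h
    exact ⟨z, hz, h1.trans hpx'.symm, fun m hm => h2 m (by omega), i + w.length, by omega, h3⟩
  · obtain ⟨i, hi, hiw, h, -⟩ := (hcross M).2
    obtain ⟨z, hz, h1, h2, h3⟩ := build x hx x' hx' hpx hpx' i hiw h
    exact ⟨z, hz, h1.trans hpx.symm, fun m hm => h3 m (by omega), i, by omega, h2⟩
  · obtain ⟨i, hi, hiw, -, h⟩ := (hcross M).2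
    obtain ⟨z, hz, h1, h2, h3⟩ := build x' hx' x hx hpx' hpx i hiw h
    exact ⟨z, hz, h1.trans hpx'.symm, fun m hm => h3 m (by omega), i, by omega, h2⟩

end Concrete

theorem transClass_eq_revClass [Fintype A] [TopologicalSpace A] [DiscreteTopology A]
    [Fintype B] [TopologicalSpace B] [DiscreteTopology B]
    (X : Set (ℤ → A)) (Y : Set (ℤ → B)) (π : (ℤ → A) → ℤ → B)
    (hT : FactorTriple X Y π) (hXirr : IrreducibleSubshift X)
    (y : ℤ → B) (hy : DoublyTransitive Y y)
    (x : ℤ → A) (hx : x ∈ X) (hpx : π x = y) :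
    transClass X π x = revClass X π x := by
  ext x'
  constructor
  · rintro ⟨hx', hp, h1, -⟩
    obtain ⟨z, hz, hpz, ha, i, -, hb⟩ := h1 0
    exact ⟨hx', hp, (all_transitions X Y π hT hXirr y hy x hx hpx x' hx' (hp.trans hpx) z hz
      (hpz.trans hpx) 0 i ha hb).2⟩
  · rintro ⟨hx', hp, h1, -⟩
    obtain ⟨z, hz, hpz, hb, i, -, ha⟩ := h1 0
    exact ⟨hx', hp, (all_transitions X Y π hT hXirr y hy x hx hpx x' hx' (hp.trans hpx) z hz
      (hpz.trans hpx) i 0 ha hb).1⟩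
end

section
/- Let (X, Y, π) be an irreducible factor triple with X one-step and π one-block, and X̄ a proper subshift of X with π(X̄) = Y. Then there exists a positive integer N such that for every block v̄ ∈ B(X) \ B(X̄) there is an (X̄, v̄)-diamond of length less than |v̄| + N. -/
open Set

universe u v uc

variable {A : Type u} {B : Type v}

/-- Binary relations on `A`, as a monoid under composition. -/
def BRel (A : Type u) := A → A → Prop

namespace BRel

instance instMonoid : Monoid (BRel A) where
  mul r s := fun a b => ∃ c, r a c ∧ s c b
  one := fun a b => a = b
  mul_assoc r s t := by
    funext a b
    apply propext
    constructor
    · rintro ⟨c, ⟨d, h1, h2⟩, h3⟩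
      exact ⟨d, h1, c, h2, h3⟩
    · rintro ⟨d, h1, c, h2, h3⟩
      exact ⟨c, ⟨d, h1, h2⟩, h3⟩
  one_mul r := by
    funext a b
    apply propext
    constructor
    · rintro ⟨c, h1, h2⟩
      cases h1
      exact h2
    · intro h
      exact ⟨a, rfl, h⟩
  mul_one r := by
    funext a b
    apply propext
    constructor
    · rintro ⟨c, h1, h2⟩
      cases h2
      exact h1
    · intro h
      exact ⟨b, h, rfl⟩

theorem mul_iff (r s : BRel A) (a b : A) : (r * s) a b ↔ ∃ c, r a c ∧ s c b := Iff.rfl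

theorem one_iff (a b : A) : (1 : BRel A) a b ↔ a = b := Iff.rfl

theorem mul_mk {r s : BRel A} {a b c : A} (h : r a c) (h' : s c b) : (r * s) a b := ⟨c, h, h'⟩

instance instFiniteBRel [Finite A] : Finite (BRel A) := by
  unfold BRel
  infer_instance

theorem pow_diag {p : BRel A} {b : A} (h : p b b) (m : ℕ) : (p ^ m) b b := by
  induction m with
  | zero => rw [pow_zero]; exact rfl
  | succ k ih => rw [pow_succ]; exact ⟨b, ih, h⟩

/-- Some positive power of an element of a finite monoid is idempotent. -/
theorem exists_pow_idem {M : Type*} [Monoid M] [Finite M] (g : M) :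
    ∃ m : ℕ, g ^ (m + 1) * g ^ (m + 1) = g ^ (m + 1) := by
  obtain ⟨i, j, hne, hij⟩ := Finite.exists_ne_map_eq_of_infinite (fun n : ℕ => g ^ n)
  wlog hlt : i < j generalizing i j
  · exact this j i hne.symm hij.symm (by omega)
  obtain ⟨d, rfl⟩ := Nat.exists_eq_add_of_lt hlt
  replace hij : g ^ i = g ^ (i + d + 1) := hij
  have key : ∀ k l : ℕ, g ^ (i + l + k * (d + 1)) = g ^ (i + l) := by
    intro k
    induction k with
    | zero => intro l; simp
    | succ k ih =>
      intro l
      have h1 : i + l + (k + 1) * (d + 1) = (i + d + 1) + (l + k * (d + 1)) := by ring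
      rw [h1, pow_add, ← hij, ← pow_add, ← add_assoc]
      exact ih l
  refine ⟨i + (i + 1) * d, ?_⟩
  have h2 : i + (i + 1) * d + 1 = (i + 1) * (d + 1) := by ring
  rw [← pow_add]
  have h3 : i + (i + 1) * d + 1 + (i + (i + 1) * d + 1)
    = i + ((i + 1) * d + 1) + (i + 1) * (d + 1) := by ring
  rw [h3, key]
  congr 1

/-- A minimal idempotent (among those having a fixed point in `V`). -/
theorem exists_min_idem [Finite A] (S : Submonoid (BRel A)) (V : Set A) (hV : V.Nonempty) :
    ∃ e ∈ S, e * e = e ∧ (∃ f ∈ V, e f f) ∧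
      ∀ p ∈ S, e * p = p → p * e = p → ∀ b ∈ V, p b b → ∃ m : ℕ, p ^ (m + 1) = e := by
  let lt : BRel A → BRel A → Prop := fun e' e => e' ≠ e ∧ e * e' = e' ∧ e' * e = e'
  have : Std.Irrefl lt := ⟨fun e h => h.1 rfl⟩
  have : IsTrans (BRel A) lt := ⟨by
    rintro a b c ⟨h1, h2, h3⟩ ⟨h4, h5, h6⟩
    refine ⟨?_, ?_, ?_⟩
    · rintro rfl
      exact h1 (by rw [← h2, h6])
    · rw [← h2, ← mul_assoc, h5]
    · rw [← h3, mul_assoc, h6]⟩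
  have wf := Finite.wellFounded_of_trans_of_irrefl lt
  obtain ⟨f0, hf0⟩ := hV
  obtain ⟨e, ⟨heS, hee, hf⟩, hmin⟩ := wf.has_min
    {e | e ∈ S ∧ e * e = e ∧ ∃ f ∈ V, e f f} ⟨1, S.one_mem, one_mul 1, f0, hf0, rfl⟩
  refine ⟨e, heS, hee, hf, ?_⟩
  intro p hp hep hpe b hb hbb
  obtain ⟨m, hm⟩ := exists_pow_idem p
  refine ⟨m, ?_⟩
  by_contra hne
  refine hmin (p ^ (m + 1)) ⟨S.pow_mem hp _, hm, b, hb, pow_diag hbb _⟩ ⟨hne, ?_, ?_⟩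
  · rw [pow_succ', ← mul_assoc, hep]
  · rw [pow_succ, mul_assoc, hpe]

/-- An idempotent relation on a finite type factors through its fixed points. -/
theorem idem_factor [Finite A] {e : BRel A} (hee : e * e = e) {a b : A} (h : e a b) :
    ∃ c, e a c ∧ e c c ∧ e c b := by
  by_contra hcon
  push Not at hcon
  have htr : ∀ {x y z}, e x y → e y z → e x z := by
    intro x y z h1 h2
    rw [← hee]
    exact ⟨y, h1, h2⟩
  let Z := {c // e a c ∧ e c b}
  let r : Z → Z → Prop := fun x y => e x.1 y.1
  have : Std.Irrefl r := ⟨fun x hx => hcon x.1 x.2.1 hx x.2.2⟩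
  have : IsTrans Z r := ⟨fun x y z h1 h2 => htr h1 h2⟩
  have wf := Finite.wellFounded_of_trans_of_irrefl r
  have hne : (Set.univ : Set Z).Nonempty := by
    have h' := h
    rw [← hee] at h'
    obtain ⟨c, h1, h2⟩ := h'
    exact ⟨⟨c, h1, h2⟩, trivial⟩
  obtain ⟨c, -, hc⟩ := wf.has_min _ hne
  have h'' : ∀ y, e a y → (e * e) a y := by
    intro y hy
    rw [hee]
    exact hy
  obtain ⟨d, h1, h2⟩ := h'' c.1 c.2.1
  exact hc ⟨d, h1, htr h2 c.2.2⟩ trivial h2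

end BRel

/-- Allowed transitions in `X`. -/
def Step (X : Set (ℤ → A)) (a b : A) : Prop := ∃ x ∈ X, ∃ i : ℤ, x i = a ∧ x (i + 1) = b

/-- Symbols occurring in `X`. -/
def Symb (X : Set (ℤ → A)) : Set A := {a | ∃ x ∈ X, ∃ i : ℤ, x i = a}

/-- Paths over a word (the first symbol is not constrained by the word). -/
def PathRel (X : Set (ℤ → A)) (Φ : A → B) : List B → BRel A
  | [] => 1
  | β :: U => fun a b => ∃ c, Step X a c ∧ Φ c = β ∧ PathRel X Φ U c b

/-- The image of `x` reads the word `U` at positions `i+1, i+2, …`. -/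
def Occ (Φ : A → B) (x : ℤ → A) : ℤ → List B → Prop
  | _, [] => True
  | i, β :: U => Φ (x (i + 1)) = β ∧ Occ Φ x (i + 1) U

/-- The word read at positions `i+1, …, i+n`. -/
def readWord (Φ : A → B) (x : ℤ → A) : ℤ → ℕ → List B
  | _, 0 => []
  | i, n + 1 => Φ (x (i + 1)) :: readWord Φ x (i + 1) n

theorem readWord_length (Φ : A → B) (x : ℤ → A) (n : ℕ) :
    ∀ i, (readWord Φ x i n).length = n := by
  induction n with
  | zero => intro i; rfl
  | succ n ih => intro i; simp [readWord, ih]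

theorem occ_readWord (Φ : A → B) (x : ℤ → A) (n : ℕ) :
    ∀ i, Occ Φ x i (readWord Φ x i n) := by
  induction n with
  | zero => intro i; trivial
  | succ n ih => intro i; exact ⟨rfl, ih _⟩

theorem pathRel_append (X : Set (ℤ → A)) (Φ : A → B) (U V : List B) :
    PathRel X Φ (U ++ V) = PathRel X Φ U * PathRel X Φ V := by
  induction U with
  | nil => exact (one_mul _).symm
  | cons β U ih =>
    funext a b
    apply propext
    simp only [List.cons_append, PathRel]
    rw [ih]
    constructor
    · rintro ⟨c, h1, h2, d, h3, h4⟩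
      exact ⟨d, ⟨c, h1, h2, h3⟩, h4⟩
    · rintro ⟨d, ⟨c, h1, h2, h3⟩, h4⟩
      exact ⟨c, h1, h2, d, h3, h4⟩

theorem occ_append (Φ : A → B) (x : ℤ → A) (U V : List B) :
    ∀ i, Occ Φ x i (U ++ V) ↔ Occ Φ x i U ∧ Occ Φ x (i + U.length) V := by
  induction U with
  | nil => intro i; simp [Occ]
  | cons β U ih =>
    intro i
    simp only [List.cons_append, Occ, List.length_cons, Nat.cast_add, Nat.cast_one]
    rw [ih, and_assoc]
    have : i + 1 + (U.length : ℤ) = i + (U.length + 1) := by ring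
    rw [this]

theorem occ_congr (Φ : A → B) (U : List B) : ∀ (x z : ℤ → A) (i k : ℤ),
    (∀ j : ℕ, 1 ≤ j → j ≤ U.length → Φ (x (i + j)) = Φ (z (k + j))) →
      Occ Φ x i U → Occ Φ z k U := by
  induction U with
  | nil => intros; trivial
  | cons β U ih =>
    rintro x z i k h ⟨h1, h2⟩
    refine ⟨?_, ih x z (i + 1) (k + 1) ?_ h2⟩
    · have := h 1 le_rfl (by simp)
      simp only [Nat.cast_one] at this
      rw [← this, h1]
    · intro j hj1 hj2
      have := h (j + 1) (by omega) (by simpa using hj2)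
      push_cast at this
      rw [show i + 1 + (j : ℤ) = i + (j + 1) by ring, show k + 1 + (j : ℤ) = k + (j + 1) by ring]
      exact this

theorem occ_eq (Φ : A → B) (U : List B) : ∀ (x z : ℤ → A) (i k : ℤ),
    Occ Φ x i U → Occ Φ z k U →
      ∀ j : ℕ, 1 ≤ j → j ≤ U.length → Φ (x (i + j)) = Φ (z (k + j)) := by
  induction U with
  | nil => intro x z i k _ _ j h1 h2; simp at h2; omega
  | cons β U ih =>
    rintro x z i k ⟨h1, h2⟩ ⟨h3, h4⟩ j hj1 hj2
    rcases Nat.eq_or_lt_of_le hj1 with rfl | hj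
    · simpa using h1.trans h3.symm
    · obtain ⟨l, rfl⟩ : ∃ l, j = l + 1 := ⟨j - 1, by omega⟩
      have := ih x z (i + 1) (k + 1) h2 h4 l (by omega) (by simpa using hj2)
      push_cast
      rw [show i + ((l : ℤ) + 1) = i + 1 + l by ring, show k + ((l : ℤ) + 1) = k + 1 + l by ring]
      exact this

theorem pathRel_of_occ {X : Set (ℤ → A)} (Φ : A → B) {x : ℤ → A} (hx : x ∈ X) (U : List B) :
    ∀ i, Occ Φ x i U → PathRel X Φ U (x i) (x (i + U.length)) := by
  induction U with
  | nil => intro i _; simp [PathRel, BRel.one_iff]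
  | cons β U ih =>
    rintro i ⟨h1, h2⟩
    refine ⟨x (i + 1), ⟨x, hx, i, rfl, rfl⟩, h1, ?_⟩
    have := ih (i + 1) h2
    rw [show i + ((β :: U).length : ℤ) = i + 1 + U.length by simp; ring]
    exact this

theorem symb_of_pathRel {X : Set (ℤ → A)} (Φ : A → B) (U : List B) :
    ∀ {a b : A}, a ∈ Symb X → PathRel X Φ U a b → b ∈ Symb X := by
  induction U with
  | nil => rintro a b h rfl; exact h
  | cons β U ih =>
    rintro a b h ⟨c, ⟨x, hx, i, h1, h2⟩, -, h3⟩
    exact ih ⟨x, hx, i + 1, h2⟩ h3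

/-- Gluing of two points of a one-step shift along a common symbol. -/
theorem glue [TopologicalSpace A] {X : Set (ℤ → A)} (hX : IsOneStep X) {x x' : ℤ → A}
    (hx : x ∈ X) (hx' : x' ∈ X) (i k : ℤ) (h : x i = x' k) :
    ∃ z ∈ X, (∀ m ≤ i, z m = x m) ∧ ∀ m : ℤ, 0 ≤ m → z (i + m) = x' (k + m) := by
  obtain ⟨-, T, rfl⟩ := hX
  refine ⟨fun m => if m ≤ i then x m else x' (k + (m - i)), ?_, ?_, ?_⟩
  · intro m
    by_cases h1 : m + 1 ≤ i
    · have h2 : m ≤ i := by omega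
      simp only [h1, h2, if_true]
      exact hx m
    · by_cases h2 : m ≤ i
      · have : m = i := by omega
        subst this
        simp only [h1, h2, if_true, if_false]
        rw [h, show k + (m + 1 - m) = k + 1 by ring]
        exact hx' k
      · simp only [h1, h2, if_false]
        rw [show k + (m + 1 - i) = k + (m - i) + 1 by ring]
        exact hx' _
  · intro m hm
    simp [hm]
  · intro m hm
    by_cases h1 : i + m ≤ i
    · have : m = 0 := by omega
      subst this
      simp [h]
    · simp only [h1, if_false]
      congr 1
      ring

/-- Paths extend points. -/
theorem extend_path [TopologicalSpace A] {X : Set (ℤ → A)} (hX : IsOneStep X) (Φ : A → B)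
    (U : List B) : ∀ {x : ℤ → A}, x ∈ X → ∀ (i : ℤ) {b : A}, PathRel X Φ U (x i) b →
      ∃ z ∈ X, (∀ m ≤ i, z m = x m) ∧ z (i + U.length) = b ∧ Occ Φ z i U := by
  induction U with
  | nil =>
    intro x hx i b h
    refine ⟨x, hx, fun _ _ => rfl, ?_, trivial⟩
    have h' : x i = b := h
    simpa using h'
  | cons β U ih =>
    rintro x hx i b ⟨c, ⟨x', hx', k, h1, h2⟩, h3, h4⟩
    obtain ⟨z1, hz1, hz2, hz3⟩ := glue hX hx hx' i k h1.symm
    have hc : z1 (i + 1) = c := by rw [hz3 1 (by norm_num), h2]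
    rw [← hc] at h4
    obtain ⟨z, hz, h5, h6, h7⟩ := ih hz1 (i + 1) h4
    refine ⟨z, hz, ?_, ?_, ?_, h7⟩
    · intro m hm
      rw [h5 m (by omega), hz2 m hm]
    · rw [← h6]
      congr 1
      simp
      ring
    · rw [h5 _ le_rfl, hc, h3]

theorem exists_path [TopologicalSpace A] {X : Set (ℤ → A)} (hXirr : IrreducibleSubshift X)
    (Φ : A → B) {a b : A} (ha : a ∈ Symb X) (hb : b ∈ Symb X) : ∃ U, PathRel X Φ U a b := by
  obtain ⟨x, hx, i, rfl⟩ := ha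
  obtain ⟨x', hx', i', rfl⟩ := hb
  obtain ⟨z, hz, s, t, hst, h1, h2⟩ := hXirr 1 1 (fun _ => x i) (fun _ => x' i')
    ⟨x, hx, i, by intro j; simp [Fin.fin_one_eq_zero j]⟩
    ⟨x', hx', i', by intro j; simp [Fin.fin_one_eq_zero j]⟩
  have h1 := h1 0
  have h2 := h2 0
  simp at h1 h2
  refine ⟨readWord Φ z s (t - s).toNat, ?_⟩
  have := pathRel_of_occ Φ hz _ s (occ_readWord Φ z (t - s).toNat s)
  rw [readWord_length] at this
  rw [← h1, ← h2]
  convert this using 2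
  push_cast at hst
  omega

theorem make_diamond [TopologicalSpace A] {X Xbar : Set (ℤ → A)} (hX : IsOneStep X)
    (hsub : Xbar ⊆ X) (Φ : A → B) {n : ℕ} (vbar : Fin (n + 1) → A) {y : ℤ → A} (hy : y ∈ X)
    {s : ℤ} (hys : ∀ j : Fin (n + 1), y (s + (j.1 : ℤ)) = vbar j) {xb : ℤ → A} (hxb : xb ∈ Xbar)
    (t : ℤ) (Q1 Q2 : List B) (hocc : Occ Φ xb t (Q1 ++ readWord Φ y s n ++ Q2))
    (h1 : PathRel X Φ Q1 (xb t) (y s))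
    (h2 : PathRel X Φ Q2 (y (s + n)) (xb (t + (Q1.length + n + Q2.length : ℕ)))) :
    ∃ u v : Fin (Q1.length + n + Q2.length + 1) → A, IsDiamond X Xbar Φ vbar u v := by
  obtain ⟨z1, hz1, hz1a, hz1b, hz1c⟩ := extend_path hX Φ Q1 (hsub hxb) t h1
  obtain ⟨z2, hz2, hz2a, hz2b⟩ := glue hX hz1 hy (t + Q1.length) s hz1b
  rw [← hz2b n (by positivity)] at h2
  obtain ⟨z, hz, hza, hzb, hzc⟩ := extend_path hX Φ Q2 hz2 _ h2
  have hzv : ∀ j : ℕ, j ≤ n → z (t + Q1.length + j) = y (s + j) := by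
    intro j hj
    rw [hza _ (by omega), hz2b _ (by positivity)]
  have hz0 : ∀ m ≤ t + (Q1.length : ℤ), z m = z1 m := by
    intro m hm
    rw [hza _ (by omega), hz2a _ hm]
  have hzocc : Occ Φ z t (Q1 ++ readWord Φ y s n ++ Q2) := by
    rw [occ_append, occ_append]
    refine ⟨⟨?_, ?_⟩, ?_⟩
    · refine occ_congr Φ Q1 z1 z t t ?_ hz1c
      intro j _ hj
      rw [hz0 _ (by omega)]
    · refine occ_congr Φ _ y z s _ ?_ (occ_readWord Φ y n s)
      intro j _ hj
      rw [readWord_length] at hj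
      rw [hzv j hj]
    · rw [List.length_append, readWord_length]
      push_cast
      rw [← add_assoc]
      exact hzc
  have ht : z t = xb t := by rw [hz0 _ (by omega), hz1a _ le_rfl]
  refine ⟨fun j => xb (t + (j.1 : ℤ)), fun j => z (t + (j.1 : ℤ)), ⟨xb, hxb, t, fun _ => rfl⟩,
    ⟨z, hz, t, fun _ => rfl⟩, ?_, ⟨Q1.length, by omega, ?_⟩, ?_, ?_⟩
  · intro j
    rcases Nat.eq_zero_or_pos j.1 with h0 | h0
    · simp only [h0, Nat.cast_zero, add_zero, ht]
    · refine occ_eq Φ _ xb z t t hocc hzocc j.1 h0 ?_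
      have := j.2
      simp only [List.length_append, readWord_length]
      omega
  · intro j
    have := hzv j.1 (by omega)
    rw [← hys j, ← this]
    push_cast
    ring_nf
  · simp [ht]
  · simp only [Fin.val_last]
    rw [← hzb]
    congr 1
    push_cast
    ring

/-- The properties of a minimal idempotent word. -/
theorem exists_min_word [Finite A] [TopologicalSpace A] {X : Set (ℤ → A)}
    (hXirr : IrreducibleSubshift X) (Φ : A → B) (hne : (Symb X).Nonempty) :
    ∃ W : List B, PathRel X Φ W * PathRel X Φ W = PathRel X Φ W ∧
      (∃ f ∈ Symb X, PathRel X Φ W f f) ∧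
      (∀ U : List B, ∀ a ∈ Symb X, PathRel X Φ W a a → ∀ b b' : A, PathRel X Φ W b b →
        PathRel X Φ (W ++ U ++ W) a b → PathRel X Φ (W ++ U ++ W) a b' → PathRel X Φ W b b') ∧
      (∀ U : List B, (∃ a ∈ Symb X, ∃ b, PathRel X Φ (W ++ U ++ W) a b) →
        ∀ c ∈ Symb X, PathRel X Φ W c c → ∃ b, PathRel X Φ (W ++ U ++ W) c b) := by
  let S : Submonoid (BRel A) :=
    { carrier := Set.range (PathRel X Φ)
      one_mem' := ⟨[], rfl⟩
      mul_mem' := by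
        rintro _ _ ⟨U, rfl⟩ ⟨V, rfl⟩
        exact ⟨U ++ V, pathRel_append X Φ U V⟩ }
  obtain ⟨e, ⟨W, hW⟩, hee, hf, hmin⟩ := BRel.exists_min_idem S (Symb X) hne
  refine ⟨W, by rw [hW, hee], by rw [hW]; exact hf, ?_, ?_⟩
  · intro U a ha haa b b' hbb h1 h2
    have hb := symb_of_pathRel Φ _ ha h1
    obtain ⟨T, hT⟩ := exists_path hXirr Φ hb ha
    have hp : PathRel X Φ (W ++ T ++ W ++ (W ++ U ++ W)) =
        e * PathRel X Φ T * e * (e * PathRel X Φ U * e) := by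
      simp only [pathRel_append, hW]
    have hpre : ∀ d, PathRel X Φ (W ++ U ++ W) a d →
        PathRel X Φ (W ++ T ++ W ++ (W ++ U ++ W)) b d := by
      intro d hd
      rw [pathRel_append, pathRel_append, pathRel_append]
      exact ⟨a, ⟨a, ⟨b, hbb, hT⟩, haa⟩, hd⟩
    obtain ⟨m, hm⟩ := hmin _ ⟨_, rfl⟩ (by rw [hp]; simp only [← mul_assoc, hee])
      (by rw [hp]; simp only [mul_assoc, hee]) b hb (hpre b h1)
    rw [hW, ← hm, pow_succ]
    exact ⟨b, BRel.pow_diag (hpre b h1) m, hpre b' h2⟩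
  · rintro U ⟨a, ha, b, hab⟩ c hc hcc
    have hb := symb_of_pathRel Φ _ ha hab
    rw [List.append_assoc, pathRel_append] at hab
    obtain ⟨d, hd1, hd2⟩ := hab
    obtain ⟨a', h1, h2, h3⟩ := BRel.idem_factor (by rw [hW, hee]) hd1
    have ha' := symb_of_pathRel Φ _ ha h1
    have hab' : PathRel X Φ (W ++ U ++ W) a' b := by
      rw [List.append_assoc, pathRel_append]
      exact ⟨d, h3, hd2⟩
    obtain ⟨T, hT⟩ := exists_path hXirr Φ hb ha'
    have hp : PathRel X Φ (W ++ U ++ W ++ (T ++ W)) =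
        e * PathRel X Φ U * e * (PathRel X Φ T * e) := by
      simp only [pathRel_append, hW]
    have hdiag : PathRel X Φ (W ++ U ++ W ++ (T ++ W)) a' a' := by
      rw [pathRel_append, pathRel_append X Φ T W]
      exact ⟨b, hab', a', hT, h2⟩
    obtain ⟨m, hm⟩ := hmin _ ⟨_, rfl⟩ (by rw [hp]; simp only [← mul_assoc, hee])
      (by rw [hp]; simp only [mul_assoc, hee]) a' ha' hdiag
    rw [hW, ← hm, pow_succ', pathRel_append] at hcc
    obtain ⟨x, ⟨y, hy, -⟩, -⟩ := hcc
    exact ⟨y, hy⟩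

theorem exists_diamond_with_bounded_length [Fintype A] [TopologicalSpace A] [DiscreteTopology A]
    [Fintype B] [TopologicalSpace B] [DiscreteTopology B]
    (X Xbar : Set (ℤ → A)) (Y : Set (ℤ → B)) (π : (ℤ → A) → ℤ → B) (Φ : A → B)
    (hT : FactorTriple X Y π) (hXirr : IrreducibleSubshift X) (hX1 : IsOneStep X)
    (hΦ : OneBlockRule π Φ)
    (hXbar : IsSubshift Xbar) (hsub : Xbar ⊆ X) (hproper : Xbar ≠ X)
    (honto : π '' Xbar = Y) :
    ∃ N : ℕ, 0 < N ∧ ∀ (q : ℕ) (vbar : Fin q → A),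
      OccursIn vbar X → ¬ OccursIn vbar Xbar →
        ∃ (p : ℕ) (u v : Fin (p + 1) → A),
          IsDiamond X Xbar Φ vbar u v ∧ p + 1 < q + N := by
  classical
  have hlift : ∀ x ∈ X, ∃ xb ∈ Xbar, ∀ i, Φ (xb i) = Φ (x i) := by
    intro x hx
    have h1 : π x ∈ π '' Xbar := by rw [honto]; exact hT.2.2.2.1 x hx
    obtain ⟨xb, hxb, h2⟩ := h1
    refine ⟨xb, hxb, fun i => ?_⟩
    rw [← hΦ, ← hΦ, h2]
  by_cases hne : (Symb X).Nonempty
  swap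
  · refine ⟨1, one_pos, ?_⟩
    rintro q vbar ⟨x, hx, i, -⟩
    exact absurd ⟨x i, x, hx, i, rfl⟩ hne
  obtain ⟨W, hee, ⟨f, hfX, hff⟩, hdet, hrow⟩ := exists_min_word hXirr Φ hne
  have htr : ∀ {a b c}, PathRel X Φ W a b → PathRel X Φ W b c → PathRel X Φ W a c := by
    intro a b c h1 h2
    rw [← hee]
    exact ⟨b, h1, h2⟩
  -- connecting words from and to `f`, of bounded length
  have hto : ∀ c : A, ∃ P : List B, c ∈ Symb X → PathRel X Φ P f c := by
    intro c
    by_cases hc : c ∈ Symb X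
    · obtain ⟨P, hP⟩ := exists_path hXirr Φ hfX hc
      exact ⟨P, fun _ => hP⟩
    · exact ⟨[], fun h => absurd h hc⟩
  have hfrom : ∀ c : A, ∃ P : List B, c ∈ Symb X → PathRel X Φ P c f := by
    intro c
    by_cases hc : c ∈ Symb X
    · obtain ⟨P, hP⟩ := exists_path hXirr Φ hc hfX
      exact ⟨P, fun _ => hP⟩
    · exact ⟨[], fun h => absurd h hc⟩
  choose P1 hP1 using hto
  choose P2 hP2 using hfrom
  obtain ⟨K1, hK1⟩ : ∃ K, ∀ c, (P1 c).length ≤ K :=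
    ⟨∑ c, (P1 c).length, fun c => Finset.single_le_sum (f := fun c => (P1 c).length)
      (fun _ _ => Nat.zero_le _) (Finset.mem_univ c)⟩
  obtain ⟨K2, hK2⟩ : ∃ K, ∀ c, (P2 c).length ≤ K :=
    ⟨∑ c, (P2 c).length, fun c => Finset.single_le_sum (f := fun c => (P2 c).length)
      (fun _ _ => Nat.zero_le _) (Finset.mem_univ c)⟩
  refine ⟨2 * W.length + K1 + K2 + 1, by omega, ?_⟩
  intro q vbar hvX hvn
  obtain ⟨y, hy, s, hys⟩ := hvX
  obtain _ | n := q
  · exfalso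
    obtain ⟨xb, hxb, -⟩ := hlift y hy
    exact hvn ⟨xb, hxb, 0, fun j => j.elim0⟩
  set c0 := y s with hc0
  set c1 := y (s + n) with hc1
  have hc0X : c0 ∈ Symb X := ⟨y, hy, s, rfl⟩
  have hc1X : c1 ∈ Symb X := ⟨y, hy, s + n, rfl⟩
  set V := readWord Φ y s n with hV
  have hVpath : PathRel X Φ V c0 c1 := by
    have := pathRel_of_occ Φ hy _ s (occ_readWord Φ y n s)
    rw [readWord_length] at this
    exact this
  have hlen1 := hK1 c0
  have hlen2 := hK2 c1
  by_contra hcon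
  -- no reroutable window
  have hbad : ∀ xb ∈ Xbar, ∀ t : ℤ, Occ Φ xb t (W ++ (P1 c0 ++ V ++ P2 c1) ++ W) →
      PathRel X Φ W (xb t) f →
      ¬ PathRel X Φ W f (xb (t + ((W ++ (P1 c0 ++ V ++ P2 c1) ++ W).length : ℕ))) := by
    intro xb hxb t hocc h1 h2
    apply hcon
    have hl : (W ++ (P1 c0 ++ V ++ P2 c1) ++ W).length =
        (W ++ P1 c0).length + n + (P2 c1 ++ W).length := by
      simp only [List.length_append, hV, readWord_length]
      ring
    rw [hl] at h2
    obtain ⟨u, v, huv⟩ := make_diamond hX1 hsub Φ vbar hy hys hxb t (W ++ P1 c0) (P2 c1 ++ W)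
      (by simpa only [List.append_assoc] using hocc)
      (by rw [pathRel_append]; exact ⟨f, h1, hP1 c0 hc0X⟩)
      (by rw [pathRel_append]; exact ⟨f, hP2 c1 hc1X, h2⟩)
    refine ⟨_, u, v, huv, ?_⟩
    simp only [List.length_append]
    omega
  set Sw := P1 c0 ++ V ++ P2 c1 with hSw
  have hSff : PathRel X Φ Sw f f := by
    rw [hSw, pathRel_append, pathRel_append]
    exact ⟨c1, ⟨c0, hP1 c0 hc0X, hVpath⟩, hP2 c1 hc1X⟩
  have hWSW : PathRel X Φ (W ++ Sw ++ W) f f := by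
    rw [pathRel_append, pathRel_append]
    exact ⟨f, ⟨f, hff, hSff⟩, hff⟩
  have main : ∀ C : Finset A, ∃ U : List B,
      (∃ a ∈ Symb X, ∃ b, PathRel X Φ (W ++ U ++ W) a b) ∧
      ∀ xb ∈ Xbar, ∀ t : ℤ, Occ Φ xb t (W ++ U ++ W) → ∀ a, PathRel X Φ W (xb t) a →
        PathRel X Φ W a a → PathRel X Φ W a (xb (t + W.length)) → a ∉ C := by
    intro C
    induction C using Finset.induction_on with
    | empty =>
      refine ⟨[], ⟨f, hfX, f, ?_⟩, ?_⟩
      · rw [List.append_nil, pathRel_append]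
        exact ⟨f, hff, hff⟩
      · intros
        simp
    | insert c C _ ih =>
      obtain ⟨U, hU1, hU2⟩ := ih
      by_cases hc : c ∈ Symb X ∧ PathRel X Φ W c c
      swap
      · refine ⟨U, hU1, ?_⟩
        intro xb hxb t hocc a h1 h2 h3
        rw [Finset.mem_insert]
        rintro (rfl | h4)
        · exact hc ⟨symb_of_pathRel Φ _ ⟨xb, hsub hxb, t, rfl⟩ h1, h2⟩
        · exact hU2 xb hxb t hocc a h1 h2 h3 h4
      obtain ⟨hcX, hcc⟩ := hc
      obtain ⟨b, hb⟩ := hrow U hU1 c hcX hcc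
      obtain ⟨T, hTp⟩ := exists_path hXirr Φ (symb_of_pathRel Φ _ hcX hb) hfX
      have hcf : PathRel X Φ (W ++ (U ++ W ++ T) ++ W) c f := by
        have : W ++ (U ++ W ++ T) ++ W = (W ++ U ++ W) ++ T ++ W := by
          simp only [List.append_assoc]
        rw [this, pathRel_append, pathRel_append]
        exact ⟨f, ⟨b, hb, hTp⟩, hff⟩
      refine ⟨U ++ W ++ T ++ W ++ Sw, ⟨c, hcX, f, ?_⟩, ?_⟩
      · have : W ++ (U ++ W ++ T ++ W ++ Sw) ++ W = (W ++ (U ++ W ++ T) ++ W) ++ Sw ++ W := by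
          simp only [List.append_assoc]
        rw [this, pathRel_append, pathRel_append]
        exact ⟨f, ⟨f, hcf, hSff⟩, hff⟩
      · intro xb hxb t hocc a h1 h2 h3
        have hassoc : W ++ (U ++ W ++ T ++ W ++ Sw) ++ W =
            (W ++ U ++ W) ++ (T ++ (W ++ Sw ++ W)) := by
          simp only [List.append_assoc]
        rw [hassoc, occ_append] at hocc
        obtain ⟨ho1, ho23⟩ := hocc
        rw [occ_append] at ho23
        obtain ⟨ho2, ho3⟩ := ho23
        rw [Finset.mem_insert]
        rintro (rfl | h4)
        swap
        · exact hU2 xb hxb t ho1 a h1 h2 h3 h4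
        have hxX := hsub hxb
        -- positions
        set t2 : ℤ := t + (W ++ U ++ W).length with ht2
        set t3 : ℤ := t2 + T.length with ht3
        have hpT := pathRel_of_occ Φ hxX T t2 ho2
        have hUW : PathRel X Φ (U ++ W) (xb (t + W.length)) (xb t2) := by
          have ho1' := ho1
          rw [List.append_assoc, occ_append] at ho1'
          have := pathRel_of_occ Φ hxX _ _ ho1'.2
          rw [show t2 = t + W.length + (U ++ W).length by
            rw [ht2]; simp only [List.length_append]; push_cast; ring]
          exact this
        have ho3' := ho3
        rw [List.append_assoc, occ_append] at ho3'
        have hpW := pathRel_of_occ Φ hxX W t3 ho3'.1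
        have hpSW : PathRel X Φ (Sw ++ W) (xb (t3 + W.length))
            (xb (t3 + ((W ++ Sw ++ W).length : ℕ))) := by
          have := pathRel_of_occ Φ hxX _ _ ho3'.2
          rw [show t3 + ((W ++ Sw ++ W).length : ℕ) = t3 + W.length + (Sw ++ W).length by
            simp only [List.length_append]; push_cast; ring]
          exact this
        obtain ⟨a2, g1, g2, g3⟩ := BRel.idem_factor hee hpW
        have hca2 : PathRel X Φ (W ++ (U ++ W ++ T) ++ W) a a2 := by
          have : W ++ (U ++ W ++ T) ++ W = W ++ (U ++ W) ++ T ++ W := by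
            simp only [List.append_assoc]
          rw [this, pathRel_append, pathRel_append, pathRel_append]
          exact ⟨xb t3, ⟨xb t2, ⟨_, h3, hUW⟩, hpT⟩, g1⟩
        have e1 := hdet _ a hcX hcc _ _ hff hcf hca2
        have e2 := hdet _ a hcX hcc _ _ g2 hca2 hcf
        have e3 : PathRel X Φ (W ++ Sw ++ W) f (xb (t3 + ((W ++ Sw ++ W).length : ℕ))) := by
          rw [List.append_assoc, pathRel_append]
          exact ⟨_, htr e1 g3, by simpa only [List.append_assoc] using hpSW⟩
        exact hbad xb hxb t3 ho3 (htr g1 e2) (hdet _ f hfX hff _ _ hff hWSW e3)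
  obtain ⟨U, ⟨a, ⟨x, hx, i, hxi⟩, b, hab⟩, hU⟩ := main Finset.univ
  rw [← hxi] at hab
  obtain ⟨z, hz, -, -, hzo⟩ := extend_path hX1 Φ _ hx i hab
  obtain ⟨xb, hxb, hxbz⟩ := hlift z hz
  have hocc : Occ Φ xb i (W ++ U ++ W) :=
    occ_congr Φ _ z xb i i (fun j _ _ => (hxbz _).symm) hzo
  have hocc' := hocc
  rw [List.append_assoc, occ_append] at hocc'
  obtain ⟨d, d1, d2, d3⟩ := BRel.idem_factor hee (pathRel_of_occ Φ (hsub hxb) W i hocc'.1)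
  exact hU xb hxb i hocc d d1 d2 d3 (Finset.mem_univ d)
end
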